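/- arXiv:cond-mat/0404483 — 2 statements merged into one kernel-verified Lean document; each statement's English description precedes it below -/
import Mathlib

section
/- (Lower bound of Proposition 1, non-interacting form.) Let d ≥ 1. There exists a function α : [0,1] → [0,∞), depending only on d and strictly positive on (0,1), such that the following holds. Let Λ ⊆ ℤ^d be finite, let V^↑, V^↓ : Λ → [0,∞) be a magnetic potential with A_↑ ∩ A_↓ = ∅, A_↑ and A_↓ nonempty, and V₀ > 2d(√d + 1), and let N_↑, N_↓ be integers with 0 ≤ N_σ ≤ |A_σ|, ρ_σ = N_σ/|A_σ|. Then S_{N↑}(h_{V^↑}) + S_{N↓}(h_{V^↓}) ≥ Σ_{σ ∈ {↑,↓}} [ e(ρ_σ)·|A_σ| + (α(ρ_σ) − γ(V₀))·B(A_σ) ], where γ(V₀) = 4d/(V₀ − 2d) + 16d³/((V₀ − 2d)² − 4d³). -/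
open MeasureTheory
open scoped Classical

/-- The tight-binding dispersion relation `ε(k) = -2 Σᵢ cos kᵢ`. -/
noncomputable def eps (d : ℕ) (k : Fin d → ℝ) : ℝ := -2 * ∑ i, Real.cos (k i)

/-- `R(E) = (2π)^{-d} λ({k ∈ [-π,π]^d : ε(k) < E})`. -/
noncomputable def Rfun (d : ℕ) (E : ℝ) : ℝ :=
  (volume {k : Fin d → ℝ | (∀ i, k i ∈ Set.Icc (-Real.pi) Real.pi) ∧ eps d k < E}).toReal
    / (2 * Real.pi) ^ d

/-- `(2π)^{-d} ∫_{k ∈ [-π,π]^d, ε(k) < E} ε(k) dk`. -/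
noncomputable def en (d : ℕ) (E : ℝ) : ℝ :=
  (∫ k in {k : Fin d → ℝ | (∀ i, k i ∈ Set.Icc (-Real.pi) Real.pi) ∧ eps d k < E},
    eps d k) / (2 * Real.pi) ^ d

/-- The `ℓ¹` distance `|x - y|₁ = Σᵢ |xᵢ - yᵢ|` on `ℤ^d`. -/
def dist1 {d : ℕ} (x y : Fin d → ℤ) : ℕ := ∑ i, (x i - y i).natAbs

/-- The boundary `B(A)`: the number of pairs `(x, y)` with `x ∈ A`, `y ∉ A`,
`|x - y|₁ = 1`. -/
noncomputable def bdry {d : ℕ} (A : Set (Fin d → ℤ)) : ℕ :=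
  Set.ncard {p : (Fin d → ℤ) × (Fin d → ℤ) | p.1 ∈ A ∧ p.2 ∉ A ∧ dist1 p.1 p.2 = 1}

/-- The sum of the `N` smallest eigenvalues (with multiplicity) of a real
symmetric matrix. -/
noncomputable def sumSmallest {n : Type*} [Fintype n] [DecidableEq n]
    (M : Matrix n n ℝ) (N : ℕ) : ℝ :=
  if h : M.IsHermitian then
    sInf ((fun s : Finset n => ∑ i ∈ s, h.eigenvalues i) '' {s : Finset n | s.card = N})
  else 0

/-- The one-particle tight-binding Hamiltonian `h_V` on `Λ`:
`(h_V)_{xy} = -1` if `|x-y|₁ = 1`, `(h_V)_{xx} = V(x)`, and `0` otherwise. -/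
noncomputable def hV (d : ℕ) (Λ : Finset (Fin d → ℤ)) (V : (Fin d → ℤ) → ℝ) :
    Matrix Λ Λ ℝ :=
  fun x y => if dist1 (x : Fin d → ℤ) (y : Fin d → ℤ) = 1 then -1
    else if (x : Fin d → ℤ) = (y : Fin d → ℤ) then V x else 0

/-- `S_N(h_V)`: the sum of the `N` smallest eigenvalues of `h_V`. -/
noncomputable def SN (d : ℕ) (Λ : Finset (Fin d → ℤ)) (V : (Fin d → ℤ) → ℝ) (N : ℕ) : ℝ :=
  sumSmallest (hV d Λ V) N

/-- `A_σ = {x ∈ Λ : V^σ(x) = 0}`. -/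
noncomputable def Aset (d : ℕ) (Λ : Finset (Fin d → ℤ)) (V : (Fin d → ℤ) → ℝ) :
    Finset (Fin d → ℤ) :=
  Λ.filter (fun x => V x = 0)

/-- `γ(V₀) = 4d/(V₀-2d) + 16d³/((V₀-2d)² - 4d³)`. -/
noncomputable def gam (d : ℕ) (V0 : ℝ) : ℝ :=
  4*(d:ℝ)/(V0 - 2*d) + 16*(d:ℝ)^3/((V0 - 2*d)^2 - 4*(d:ℝ)^3)

/-- The `2d` unit steps of the lattice `ℤ^d`. -/
def step {d : ℕ} (p : Fin d × Bool) : Fin d → ℤ := Pi.single p.1 (if p.2 then 1 else -1)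

lemma step_injective {d : ℕ} : Function.Injective (step (d := d)) := by
  rintro ⟨i, a⟩ ⟨j, b⟩ h
  have hi := congrFun h i
  have hij : i = j := by
    by_contra hne
    simp only [step, Pi.single_eq_same, Pi.single_eq_of_ne hne] at hi
    split_ifs at hi
    omega
  subst hij
  simp only [step, Pi.single_eq_same] at hi
  cases a <;> cases b <;> simp_all

lemma dist1_comm {d : ℕ} (x y : Fin d → ℤ) : dist1 x y = dist1 y x := by
  unfold dist1
  exact Finset.sum_congr rfl fun i _ => by omega

lemma dist1_eq_one_iff {d : ℕ} (x y : Fin d → ℤ) :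
    dist1 x y = 1 ↔ ∃ p, y = x + step p := by
  unfold dist1
  constructor
  · intro h
    obtain ⟨i, -, hi0⟩ := Finset.exists_ne_zero_of_sum_ne_zero (h.trans_ne one_ne_zero)
    rw [← Finset.add_sum_erase _ _ (Finset.mem_univ i)] at h
    have hi : (x i - y i).natAbs = 1 := by omega
    have hj : ∀ j ∈ Finset.univ.erase i, (x j - y j).natAbs = 0 :=
      Finset.sum_eq_zero_iff.1 (by omega)
    have hy : ∀ s : ℤ, y i = x i + s → y = x + Pi.single i s := by
      intro s hs
      funext j
      by_cases hji : j = i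
      · subst hji; simpa using hs
      · have := hj j (by simp [hji])
        simp only [Pi.add_apply, Pi.single_eq_of_ne hji]
        omega
    by_cases hs : y i = x i + 1
    · exact ⟨(i, true), by simpa [step] using hy 1 hs⟩
    · exact ⟨(i, false), by simpa [step] using hy (-1) (by omega)⟩
  · rintro ⟨⟨i, b⟩, rfl⟩
    rw [Finset.sum_eq_single i]
    · cases b <;> simp [step]
    · intro j _ hj
      simp [step, Pi.single_eq_of_ne hj]
    · simp

lemma sum_neighbors {d : ℕ} {M : Type*} [AddCommMonoid M] (S : Finset (Fin d → ℤ))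
    (x : Fin d → ℤ) (f : (Fin d → ℤ) → M) :
    ∑ y ∈ S, (if dist1 x y = 1 then f y else 0)
      = ∑ p, if x + step p ∈ S then f (x + step p) else 0 := by
  rw [← Finset.sum_filter, ← Finset.sum_filter]
  have himg : S.filter (fun y => dist1 x y = 1)
      = (Finset.univ.filter fun p => x + step p ∈ S).image fun p => x + step p := by
    ext y
    simp only [Finset.mem_filter, Finset.mem_image, Finset.mem_univ, true_and, dist1_eq_one_iff]
    constructor
    · rintro ⟨hy, p, rfl⟩; exact ⟨p, hy, rfl⟩
    · rintro ⟨p, hp, rfl⟩; exact ⟨hp, p, rfl⟩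
  rw [himg, Finset.sum_image]
  intro p _ q _ h
  exact step_injective (add_left_cancel h)

/-- The number of neighbours of `x` outside `A`. -/
noncomputable def outDeg {d : ℕ} (A : Finset (Fin d → ℤ)) (x : Fin d → ℤ) : ℕ :=
  (Finset.univ.filter fun p => x + step p ∉ A).card

lemma outDeg_le {d : ℕ} (A : Finset (Fin d → ℤ)) (x : Fin d → ℤ) : outDeg A x ≤ 2 * d := by
  refine (Finset.card_le_univ _).trans ?_
  simp [mul_comm]

lemma bdry_eq_sum {d : ℕ} (A : Finset (Fin d → ℤ)) :
    bdry (A : Set (Fin d → ℤ)) = ∑ x ∈ A, outDeg A x := by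
  have hset : {p : (Fin d → ℤ) × (Fin d → ℤ) | p.1 ∈ (A : Set (Fin d → ℤ)) ∧
      p.2 ∉ (A : Set (Fin d → ℤ)) ∧ dist1 p.1 p.2 = 1}
      = ((A.sigma fun x => Finset.univ.filter fun p => x + step p ∉ A).image
        fun q => (q.1, q.1 + step q.2) : Finset ((Fin d → ℤ) × (Fin d → ℤ))) := by
    ext ⟨x, y⟩
    simp only [Set.mem_ofPred_eq, Finset.coe_image, Set.mem_image, Finset.mem_coe,
      Finset.mem_sigma, Finset.mem_filter, Finset.mem_univ, true_and, dist1_eq_one_iff,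
      Prod.mk.injEq]
    constructor
    · rintro ⟨hx, hy, p, rfl⟩; exact ⟨⟨x, p⟩, ⟨hx, hy⟩, rfl, rfl⟩
    · rintro ⟨⟨x', p⟩, ⟨hx, hy⟩, rfl, rfl⟩; exact ⟨hx, hy, p, rfl⟩
  unfold bdry
  rw [hset, Set.ncard_coe_finset, Finset.card_image_of_injOn, Finset.card_sigma]
  · rfl
  · rintro ⟨x, p⟩ _ ⟨x', p'⟩ _ h
    simp only [Prod.mk.injEq] at h
    obtain ⟨rfl, h⟩ := h
    rw [step_injective (add_left_cancel h)]

/-- The plane wave `e^{i k·x}`. -/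
noncomputable def wave {d : ℕ} (k : Fin d → ℝ) (x : Fin d → ℤ) : ℂ :=
  Complex.exp (((∑ i, k i * (x i : ℝ) : ℝ) : ℂ) * Complex.I)

lemma wave_add {d : ℕ} (k : Fin d → ℝ) (x y : Fin d → ℤ) :
    wave k (x + y) = wave k x * wave k y := by
  unfold wave
  rw [← Complex.exp_add]
  congr 1
  simp only [Pi.add_apply, Int.cast_add, mul_add, Finset.sum_add_distrib]
  push_cast
  ring

lemma norm_wave {d : ℕ} (k : Fin d → ℝ) (x : Fin d → ℤ) : ‖wave k x‖ = 1 :=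
  Complex.norm_exp_ofReal_mul_I _

lemma conj_wave_mul_wave {d : ℕ} (k : Fin d → ℝ) (x y : Fin d → ℤ) :
    (starRingEnd ℂ) (wave k x) * wave k y = wave k (y - x) := by
  have h : wave k y = wave k x * wave k (y - x) := by rw [← wave_add]; simp
  rw [h, ← mul_assoc, mul_comm (starRingEnd ℂ _), Complex.mul_conj, Complex.normSq_eq_norm_sq,
    norm_wave]
  simp

lemma wave_step_re {d : ℕ} (k : Fin d → ℝ) (p : Fin d × Bool) :
    (wave k (step p)).re = Real.cos (k p.1) := by
  unfold wave
  rw [Complex.exp_ofReal_mul_I_re, Finset.sum_eq_single p.1]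
  · rcases p with ⟨i, b⟩; cases b <;> simp [step]
  · intro j _ hj
    simp [step, Pi.single_eq_of_ne hj]
  · simp

lemma sum_wave_step {d : ℕ} (k : Fin d → ℝ) : ∑ p, wave k (step p) = -(eps d k : ℂ) := by
  have him : ∀ i, (wave k (step (i, true)) + wave k (step (i, false)))
      = ((2 * Real.cos (k i) : ℝ) : ℂ) := by
    intro i
    apply Complex.ext
    · simp only [Complex.add_re, wave_step_re, Complex.ofReal_re]; ring
    · unfold wave
      simp only [Complex.add_im, Complex.exp_ofReal_mul_I_im, Complex.ofReal_im]
      have : ∀ b, ∑ j, k j * ((step (i, b) j : ℤ) : ℝ) = k i * (if b then 1 else -1) := by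
        intro b
        rw [Finset.sum_eq_single i]
        · cases b <;> simp [step]
        · intro j _ hj
          simp [step, Pi.single_eq_of_ne hj]
        · simp
      simp [this]
  rw [Fintype.sum_prod_type]
  simp only [Fintype.sum_bool, him, eps]
  push_cast
  rw [Finset.mul_sum, ← Finset.sum_neg_distrib]
  simp

lemma continuous_wave {d : ℕ} (x : Fin d → ℤ) : Continuous fun k : Fin d → ℝ => wave k x := by
  unfold wave; fun_prop

lemma continuous_eps (d : ℕ) : Continuous (eps d) := by
  unfold eps; fun_prop

lemma abs_eps_le (d : ℕ) (k : Fin d → ℝ) : |eps d k| ≤ 2 * d := by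
  unfold eps
  rw [abs_mul]
  have : |∑ i, Real.cos (k i)| ≤ ∑ i : Fin d, (1 : ℝ) :=
    (Finset.abs_sum_le_sum_abs _ _).trans (Finset.sum_le_sum fun i _ => Real.abs_cos_le_one _)
  simp at this
  norm_num
  exact this

/-- The uniform probability measure on the Brillouin zone `[-π, π]^d`. -/
noncomputable def bz (d : ℕ) : Measure (Fin d → ℝ) :=
  (ENNReal.ofReal ((2 * Real.pi) ^ d))⁻¹ •
    volume.restrict {k : Fin d → ℝ | ∀ i, k i ∈ Set.Icc (-Real.pi) Real.pi}

lemma cube_eq_pi (d : ℕ) : {k : Fin d → ℝ | ∀ i, k i ∈ Set.Icc (-Real.pi) Real.pi}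
    = Set.univ.pi fun _ => Set.Icc (-Real.pi) Real.pi := by
  ext; simp only [Set.mem_ofPred_eq, Set.mem_univ_pi]

lemma two_pi_pow_pos (d : ℕ) : 0 < (2 * Real.pi) ^ d := by positivity

lemma integral_bz {d : ℕ} {G : Type*} [NormedAddCommGroup G] [NormedSpace ℝ G]
    (f : (Fin d → ℝ) → G) :
    ∫ k, f k ∂bz d = ((2 * Real.pi) ^ d)⁻¹ •
      ∫ k in {k : Fin d → ℝ | ∀ i, k i ∈ Set.Icc (-Real.pi) Real.pi}, f k := by
  unfold bz
  rw [integral_smul_measure, ENNReal.toReal_inv, ENNReal.toReal_ofReal (two_pi_pow_pos d).le]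

lemma volume_cube (d : ℕ) :
    volume {k : Fin d → ℝ | ∀ i, k i ∈ Set.Icc (-Real.pi) Real.pi}
      = ENNReal.ofReal ((2 * Real.pi) ^ d) := by
  rw [cube_eq_pi, volume_pi_pi]
  simp [← two_mul, ENNReal.ofReal_pow Real.pi_pos.le, ENNReal.ofReal_mul, mul_pow]

instance (d : ℕ) : IsProbabilityMeasure (bz d) := by
  constructor
  unfold bz
  simp only [Measure.smul_apply, Measure.restrict_apply_univ, volume_cube, smul_eq_mul]
  exact ENNReal.inv_mul_cancel (by simpa using two_pi_pow_pos d) ENNReal.ofReal_ne_top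

lemma measurableSet_lt_eps (d : ℕ) (E : ℝ) : MeasurableSet {k | eps d k < E} :=
  measurableSet_lt (continuous_eps d).measurable measurable_const

lemma Rfun_eq (d : ℕ) (E : ℝ) : Rfun d E = (bz d).real {k | eps d k < E} := by
  unfold Rfun bz Measure.real
  rw [Measure.smul_apply, Measure.restrict_apply (measurableSet_lt_eps d E), smul_eq_mul,
    ENNReal.toReal_mul, ENNReal.toReal_inv, ENNReal.toReal_ofReal (two_pi_pow_pos d).le,
    div_eq_inv_mul, Set.inter_comm]
  rfl

lemma en_eq (d : ℕ) (E : ℝ) : en d E = ∫ k in {k | eps d k < E}, eps d k ∂bz d := by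
  unfold en bz
  rw [Measure.restrict_smul, Measure.restrict_restrict (measurableSet_lt_eps d E),
    integral_smul_measure, ENNReal.toReal_inv, ENNReal.toReal_ofReal (two_pi_pow_pos d).le,
    div_eq_inv_mul, Set.inter_comm]
  rfl

lemma integrable_bz {d : ℕ} {G : Type*} [NormedAddCommGroup G]
    {f : (Fin d → ℝ) → G} (hf : Continuous f) : Integrable f (bz d) := by
  unfold bz
  refine Integrable.smul_measure ?_ (by simpa using two_pi_pow_pos d)
  rw [cube_eq_pi]
  exact hf.continuousOn.integrableOn_compact (isCompact_univ_pi fun _ => isCompact_Icc)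

lemma integral_exp_int (n : ℤ) :
    ∫ t in Set.Icc (-Real.pi) Real.pi, Complex.exp (((t * n : ℝ) : ℂ) * Complex.I)
      = if n = 0 then 2 * Real.pi else 0 := by
  split_ifs with h
  · simp [h, two_mul, Measure.real, Real.pi_pos.le]
  · rw [integral_Icc_eq_integral_Ioc, ← intervalIntegral.integral_of_le (by linarith [Real.pi_pos])]
    have hn : (n * Complex.I : ℂ) ≠ 0 := by simp [h]
    have := integral_exp_mul_complex (a := -Real.pi) (b := Real.pi) hn
    have h2 : ∀ t : ℝ, Complex.exp (((t * n : ℝ) : ℂ) * Complex.I)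
        = Complex.exp (n * Complex.I * t) := by
      intro t; congr 1; push_cast; ring
    simp only [h2, this]
    have h3 : Complex.exp (n * Complex.I * (Real.pi : ℝ))
        = Complex.exp (n * Complex.I * (-Real.pi : ℝ)) := by
      rw [Complex.exp_eq_exp_iff_exists_int]
      exact ⟨n, by push_cast; ring⟩
    simp [h3]

lemma integral_wave {d : ℕ} (z : Fin d → ℤ) :
    ∫ k, wave k z ∂bz d = if z = 0 then 1 else 0 := by
  rw [integral_bz, cube_eq_pi, volume_pi, Measure.restrict_pi_pi]
  have h : ∀ k : Fin d → ℝ, wave k z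
      = ∏ i, Complex.exp (((k i * z i : ℝ) : ℂ) * Complex.I) := by
    intro k
    unfold wave
    rw [← Complex.exp_sum, ← Finset.sum_mul]
    push_cast
    rfl
  simp only [h]
  rw [integral_fintype_prod_eq_prod (𝕜 := ℂ)
    (fun i (t : ℝ) => Complex.exp (((t * z i : ℝ) : ℂ) * Complex.I))]
  simp only [integral_exp_int]
  split_ifs with hz
  · subst hz
    simp
  · obtain ⟨i, hi⟩ := Function.ne_iff.1 hz
    rw [Finset.prod_eq_zero (Finset.mem_univ i)]
    · simp
    · simpa using hi

lemma integral_wave_re {d : ℕ} (z : Fin d → ℤ) :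
    ∫ k, (wave k z).re ∂bz d = if z = 0 then 1 else 0 := by
  have := integral_re (𝕜 := ℂ) (integrable_bz (continuous_wave z))
  simp only [RCLike.re_eq_complex_re] at this
  rw [this, integral_wave]
  split_ifs <;> simp

section Spectral

variable {n : Type*} [Fintype n] [DecidableEq n] {φ : n → n → ℝ}

/-- The rows of the square array `φ` form an orthonormal basis of `ℝⁿ`. -/
def IsOrthoArray (φ : n → n → ℝ) : Prop :=
  ∀ i j, ∑ x, φ i x * φ j x = if i = j then 1 else 0

lemma IsOrthoArray.complete (hφ : IsOrthoArray φ) (x y : n) :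
    ∑ j, φ j x * φ j y = if x = y then 1 else 0 := by
  have h1 : Matrix.of φ * (Matrix.of φ).transpose = 1 := by
    ext i j
    simpa [Matrix.mul_apply, Matrix.one_apply] using hφ i j
  have h1' : (Matrix.of φ).transpose * Matrix.of φ = 1 := mul_eq_one_comm.1 h1
  have h2 := congrFun (congrFun h1' x) y
  simpa [Matrix.mul_apply, Matrix.one_apply] using h2

lemma IsOrthoArray.sum_mul_sum (hφ : IsOrthoArray φ) (f : n → ℝ) (x : n) :
    ∑ j, φ j x * ∑ y, φ j y * f y = f x := by
  simp only [Finset.mul_sum]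
  rw [Finset.sum_comm]
  simp only [← mul_assoc, ← Finset.sum_mul, hφ.complete]
  simp

lemma IsOrthoArray.sum_sq (hφ : IsOrthoArray φ) (f : n → ℝ) :
    ∑ j, (∑ x, φ j x * f x) ^ 2 = ∑ x, f x ^ 2 := by
  calc ∑ j, (∑ x, φ j x * f x) ^ 2
      = ∑ j, ∑ x, f x * (φ j x * ∑ y, φ j y * f y) := by
        refine Finset.sum_congr rfl fun j _ => ?_
        rw [sq, Finset.sum_mul]
        exact Finset.sum_congr rfl fun x _ => by ring
    _ = ∑ x, f x * f x := by
        rw [Finset.sum_comm]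
        refine Finset.sum_congr rfl fun x _ => ?_
        rw [← Finset.mul_sum, hφ.sum_mul_sum]
    _ = ∑ x, f x ^ 2 := by simp only [sq]

lemma IsOrthoArray.sum_sq_le (hφ : IsOrthoArray φ) (s : Finset n) (f : n → ℝ) :
    ∑ j ∈ s, (∑ x, φ j x * f x) ^ 2 ≤ ∑ x, f x ^ 2 := by
  rw [← hφ.sum_sq f]
  exact Finset.sum_le_sum_of_subset_of_nonneg (Finset.subset_univ _) fun _ _ _ => sq_nonneg _

lemma IsOrthoArray.complex_sum_mul_sum (hφ : IsOrthoArray φ) (f : n → ℂ) (x : n) :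
    ∑ j, (φ j x : ℂ) * ∑ y, (φ j y : ℂ) * f y = f x := by
  simp only [Finset.mul_sum]
  rw [Finset.sum_comm]
  have h : ∀ y, ∑ j, (φ j x : ℂ) * ((φ j y : ℂ) * f y) = if x = y then f y else 0 := by
    intro y
    have := congrArg (fun r : ℝ => (r : ℂ) * f y) (hφ.complete x y)
    simp only [Complex.ofReal_sum, Complex.ofReal_mul, Finset.sum_mul, mul_assoc] at this
    rw [this]
    split_ifs <;> simp
  simp [h]

lemma IsOrthoArray.sum_norm_sq (hφ : IsOrthoArray φ) (f : n → ℂ) :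
    ∑ j, ‖∑ x, (φ j x : ℂ) * f x‖ ^ 2 = ∑ x, ‖f x‖ ^ 2 := by
  have key : ∀ z : ℂ, ‖z‖ ^ 2 = z.re ^ 2 + z.im ^ 2 := fun z => by
    rw [← Complex.normSq_eq_norm_sq, Complex.normSq_apply]; ring
  simp only [key, Finset.sum_add_distrib, Complex.re_sum, Complex.im_sum, Complex.re_ofReal_mul,
    Complex.im_ofReal_mul]
  rw [hφ.sum_sq fun x => (f x).re, hφ.sum_sq fun x => (f x).im]

lemma IsOrthoArray.transpose (hφ : IsOrthoArray φ) : IsOrthoArray fun x j => φ j x :=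
  hφ.complete

lemma exists_eigen_array {M : Matrix n n ℝ} (h : M.IsHermitian) :
    ∃ φ : n → n → ℝ, IsOrthoArray φ ∧
      ∀ j x, ∑ y, M x y * φ j y = h.eigenvalues j * φ j x := by
  refine ⟨fun j x => h.eigenvectorBasis j x, ?_, ?_⟩
  · intro i j
    have := orthonormal_iff_ite.1 h.eigenvectorBasis.orthonormal j i
    rw [PiLp.inner_apply] at this
    simpa [eq_comm] using this
  · intro j x
    have := congrFun (h.mulVec_eigenvectorBasis j) x
    simpa [Matrix.mulVec, dotProduct] using this

lemma quadForm_eq_sum {M : Matrix n n ℝ} {e : n → ℝ} (hφ : IsOrthoArray φ)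
    (he : ∀ j x, ∑ y, M x y * φ j y = e j * φ j x) (f : n → ℝ) :
    ∑ x, f x * ∑ y, M x y * f y = ∑ j, e j * (∑ x, φ j x * f x) ^ 2 := by
  have h1 : ∀ x, ∑ y, M x y * f y = ∑ j, e j * φ j x * ∑ y, φ j y * f y := by
    intro x
    calc ∑ y, M x y * f y = ∑ y, M x y * ∑ j, φ j y * ∑ z, φ j z * f z := by
          simp only [hφ.sum_mul_sum]
      _ = ∑ j, (∑ y, M x y * φ j y) * ∑ z, φ j z * f z := by
          rw [Finset.sum_congr rfl fun y _ => Finset.mul_sum _ _ (M x y), Finset.sum_comm]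
          refine Finset.sum_congr rfl fun j _ => ?_
          rw [Finset.sum_mul]
          exact Finset.sum_congr rfl fun y _ => (mul_assoc _ _ _).symm
      _ = _ := by simp only [he]
  simp only [h1]
  rw [Finset.sum_congr rfl fun x _ => Finset.mul_sum _ _ (f x), Finset.sum_comm]
  refine Finset.sum_congr rfl fun j _ => ?_
  rw [sq, ← mul_assoc, Finset.mul_sum (a := e j), Finset.sum_mul]
  exact Finset.sum_congr rfl fun x _ => by ring

end Spectral

/-- A fractional occupation of total mass at most `N` collects at most as much of a nonnegative
weight as some set of `N` points. -/
lemma exists_card_eq_sum_mul_le {ι : Type*} [Fintype ι] (f g : ι → ℝ) (N : ℕ)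
    (hN : N ≤ Fintype.card ι) (hf : ∀ i, 0 ≤ f i) (hg0 : ∀ i, 0 ≤ g i) (hg1 : ∀ i, g i ≤ 1)
    (hg : ∑ i, g i ≤ N) :
    ∃ s : Finset ι, s.card = N ∧ ∑ i, f i * g i ≤ ∑ i ∈ s, f i := by
  have hne : (Finset.powersetCard N (Finset.univ : Finset ι)).Nonempty :=
    Finset.powersetCard_nonempty.2 (by simpa using hN)
  obtain ⟨s, hs, hmax⟩ := Finset.exists_max_image _ (fun s => ∑ i ∈ s, f i) hne
  have hcard := (Finset.mem_powersetCard.1 hs).2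
  refine ⟨s, hcard, ?_⟩
  have hex : ∀ i ∈ s, ∀ j ∉ s, f j ≤ f i := by
    intro i hi j hj
    have hj' : j ∉ s.erase i := fun h => hj (Finset.mem_of_mem_erase h)
    have hmem : insert j (s.erase i) ∈ Finset.powersetCard N (Finset.univ : Finset ι) := by
      rw [Finset.mem_powersetCard]
      refine ⟨Finset.subset_univ _, ?_⟩
      rw [Finset.card_insert_of_notMem hj', Finset.card_erase_of_mem hi, hcard]
      have : 0 < s.card := Finset.card_pos.2 ⟨i, hi⟩
      omega
    have := hmax _ hmem
    rw [Finset.sum_insert hj', ← Finset.add_sum_erase s f hi] at this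
    linarith
  obtain ⟨t, ht0, hts, htc⟩ : ∃ t : ℝ, 0 ≤ t ∧ (∀ i ∈ s, t ≤ f i) ∧ (∀ j ∉ s, f j * g j ≤ t * g j) := by
    rcases s.eq_empty_or_nonempty with rfl | hsne
    · refine ⟨0, le_rfl, by simp, fun j _ => ?_⟩
      have h0 : ∑ i, g i = 0 := le_antisymm (by rw [← hcard] at hg; simpa using hg)
        (Finset.sum_nonneg fun i _ => hg0 i)
      rw [(Finset.sum_eq_zero_iff_of_nonneg fun i _ => hg0 i).1 h0 j (Finset.mem_univ _)]
      simp
    · obtain ⟨i, hi, hmin⟩ := Finset.exists_min_image s f hsne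
      exact ⟨f i, hf i, hmin, fun j hj => mul_le_mul_of_nonneg_right (hex i hi j hj) (hg0 j)⟩
  have h1 : ∑ i ∈ s, f i * g i ≤ ∑ i ∈ s, (f i + t * g i - t) := by
    refine Finset.sum_le_sum fun i hi => ?_
    nlinarith [hts i hi, hg1 i]
  have h2 : ∑ i ∈ sᶜ, f i * g i ≤ ∑ i ∈ sᶜ, t * g i :=
    Finset.sum_le_sum fun i hi => htc i (Finset.mem_compl.1 hi)
  rw [Finset.sum_sub_distrib, Finset.sum_add_distrib, Finset.sum_const, hcard, nsmul_eq_mul] at h1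
  have h3 := Finset.sum_add_sum_compl s fun i => f i * g i
  have h4 := Finset.sum_add_sum_compl s fun i => t * g i
  simp only [← Finset.mul_sum] at h1 h2 h4
  nlinarith [mul_le_mul_of_nonneg_left hg ht0]

lemma hV_isHermitian (d : ℕ) (Λ : Finset (Fin d → ℤ)) (V : (Fin d → ℤ) → ℝ) :
    (hV d Λ V).IsHermitian := by
  ext x y
  simp only [Matrix.conjTranspose_apply, hV, star_trivial, dist1_comm (y : Fin d → ℤ)]
  split_ifs with h1 h2 h3 h4
  · rfl
  · rw [h2]
  · exact absurd h2.symm h3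
  · exact absurd h4.symm h2
  · rfl

lemma hV_mulVec {d : ℕ} {M : Type*} [AddCommGroup M] [Module ℝ M]
    (Λ : Finset (Fin d → ℤ)) (V : (Fin d → ℤ) → ℝ) (x : Λ)
    (f : (Fin d → ℤ) → M) :
    ∑ y : Λ, hV d Λ V x y • f y = V x • f x - ∑ y ∈ Λ, if dist1 (x : Fin d → ℤ) y = 1 then f y else 0 := by
  have hxx : dist1 (x : Fin d → ℤ) x ≠ 1 := by simp [dist1]
  have h : ∀ y : Λ, hV d Λ V x y • f y
      = (if x = y then V x • f x else 0) - (if dist1 (x : Fin d → ℤ) y = 1 then f y else 0) := by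
    intro y
    unfold hV
    by_cases hxy : x = y
    · subst hxy; simp [hxx]
    · have : (x : Fin d → ℤ) ≠ y := fun h => hxy (Subtype.ext h)
      split_ifs <;> simp
  simp only [h, Finset.sum_sub_distrib]
  rw [Finset.sum_ite_eq, if_pos (Finset.mem_univ _),
    ← Finset.sum_coe_sort Λ (fun y => if dist1 (x : Fin d → ℤ) y = 1 then f y else 0)]

/-- The hopping form `∑_{x ∈ S} ∑_{y ∈ T, |x-y|=1} f x f y`. -/
noncomputable def hop {d : ℕ} (S T : Finset (Fin d → ℤ)) (f : (Fin d → ℤ) → ℝ) : ℝ :=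
  ∑ x ∈ S, f x * ∑ y ∈ T, if dist1 x y = 1 then f y else 0

lemma hop_comm {d : ℕ} (S T : Finset (Fin d → ℤ)) (f : (Fin d → ℤ) → ℝ) :
    hop S T f = hop T S f := by
  unfold hop
  simp only [Finset.mul_sum]
  rw [Finset.sum_comm]
  refine Finset.sum_congr rfl fun y _ => Finset.sum_congr rfl fun x _ => ?_
  rw [dist1_comm]
  split_ifs <;> ring

lemma abs_hop_le {d : ℕ} (S : Finset (Fin d → ℤ)) (f : (Fin d → ℤ) → ℝ) :
    |hop S S f| ≤ 2 * d * ∑ x ∈ S, f x ^ 2 := by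
  have hdeg : ∀ x, ∑ y ∈ S, (if dist1 x y = 1 then (1 : ℝ) else 0) ≤ 2 * d := by
    intro x
    rw [sum_neighbors S x fun _ => (1 : ℝ)]
    refine (Finset.sum_le_sum (g := fun _ => (1 : ℝ)) fun p _ => by split_ifs <;> norm_num).trans ?_
    simp [mul_comm]
  have h1 : |hop S S f| ≤ ∑ x ∈ S, ∑ y ∈ S,
      (if dist1 x y = 1 then (1 : ℝ) else 0) * ((f x ^ 2 + f y ^ 2) / 2) := by
    unfold hop
    refine (Finset.abs_sum_le_sum_abs _ _).trans (Finset.sum_le_sum fun x _ => ?_)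
    rw [Finset.mul_sum]
    refine (Finset.abs_sum_le_sum_abs _ _).trans (Finset.sum_le_sum fun y _ => ?_)
    split_ifs
    · rw [one_mul, abs_le]
      constructor <;> nlinarith [sq_nonneg (f x + f y), sq_nonneg (f x - f y)]
    · simp
  have h2 : ∑ x ∈ S, ∑ y ∈ S, (if dist1 x y = 1 then (1 : ℝ) else 0) * ((f x ^ 2 + f y ^ 2) / 2)
      = ∑ x ∈ S, (∑ y ∈ S, (if dist1 x y = 1 then (1 : ℝ) else 0)) * f x ^ 2 := by
    have h3 : ∑ x ∈ S, ∑ y ∈ S, (if dist1 x y = 1 then (1 : ℝ) else 0) * (f y ^ 2 / 2)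
        = ∑ x ∈ S, ∑ y ∈ S, (if dist1 x y = 1 then (1 : ℝ) else 0) * (f x ^ 2 / 2) := by
      rw [Finset.sum_comm]
      simp only [dist1_comm]
    simp only [add_div, mul_add, Finset.sum_add_distrib]
    rw [h3, ← Finset.sum_add_distrib]
    refine Finset.sum_congr rfl fun x _ => ?_
    rw [← Finset.sum_mul]; ring
  rw [h2] at h1
  refine h1.trans ?_
  rw [Finset.mul_sum]
  exact Finset.sum_le_sum fun x _ => mul_le_mul_of_nonneg_right (hdeg x) (sq_nonneg _)

lemma hV_quadForm {d : ℕ} (Λ : Finset (Fin d → ℤ)) (V f : (Fin d → ℤ) → ℝ) :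
    ∑ x : Λ, f x * ∑ y : Λ, hV d Λ V x y * f y = ∑ x ∈ Λ, V x * f x ^ 2 - hop Λ Λ f := by
  have h := fun x : Λ => hV_mulVec Λ V x f
  simp only [smul_eq_mul] at h
  simp only [h]
  rw [Finset.sum_coe_sort Λ fun x => f x * (V x * f x - ∑ y ∈ Λ, if dist1 x y = 1 then f y else 0)]
  unfold hop
  rw [← Finset.sum_sub_distrib]
  exact Finset.sum_congr rfl fun x _ => by ring

lemma hop_union {d : ℕ} {A W : Finset (Fin d → ℤ)} (h : Disjoint A W) (f : (Fin d → ℤ) → ℝ) :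
    hop (A ∪ W) (A ∪ W) f = hop A A f + 2 * hop W A f + hop W W f := by
  have h1 : ∀ S, hop (A ∪ W) S f = hop A S f + hop W S f := fun S => Finset.sum_union h
  rw [h1, hop_comm A, hop_comm W, h1, h1, hop_comm A W]
  ring

lemma quadForm_lower_bound {d : ℕ} {A W : Finset (Fin d → ℤ)} (h : Disjoint A W)
    (V f : (Fin d → ℤ) → ℝ) {V0 : ℝ} (hVA : ∀ x ∈ A, V x = 0) (hVW : ∀ x ∈ W, V0 ≤ V x)
    (hV0 : 4 * (d : ℝ) < V0) :
    -hop A A f - (∑ y ∈ W, (∑ x ∈ A, if dist1 y x = 1 then f x else 0) ^ 2) / (V0 - 4 * d)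
        + 2 * d * ∑ x ∈ W, f x ^ 2
      ≤ ∑ x ∈ A ∪ W, V x * f x ^ 2 - hop (A ∪ W) (A ∪ W) f := by
  have hM : 0 < V0 - 4 * d := by linarith
  have h1 : ∑ x ∈ A, V x * f x ^ 2 = 0 :=
    Finset.sum_eq_zero fun x hx => by rw [hVA x hx, zero_mul]
  have h2 : V0 * ∑ x ∈ W, f x ^ 2 ≤ ∑ x ∈ W, V x * f x ^ 2 := by
    rw [Finset.mul_sum]
    exact Finset.sum_le_sum fun x hx => mul_le_mul_of_nonneg_right (hVW x hx) (sq_nonneg _)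
  have h3 := (abs_le.1 (abs_hop_le W f)).2
  have h4 : 2 * hop W A f ≤ (V0 - 4 * d) * ∑ x ∈ W, f x ^ 2 +
      (∑ y ∈ W, (∑ x ∈ A, if dist1 y x = 1 then f x else 0) ^ 2) / (V0 - 4 * d) := by
    unfold hop
    rw [Finset.mul_sum, Finset.mul_sum, Finset.sum_div, ← Finset.sum_add_distrib]
    refine Finset.sum_le_sum fun y _ => ?_
    set T := ∑ x ∈ A, if dist1 y x = 1 then f x else 0
    have : (V0 - 4 * d) * f y ^ 2 + T ^ 2 / (V0 - 4 * d) - 2 * (f y * T)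
        = ((V0 - 4 * d) * f y - T) ^ 2 / (V0 - 4 * d) := by field_simp; ring
    have h5 : 0 ≤ ((V0 - 4 * d) * f y - T) ^ 2 / (V0 - 4 * d) := by positivity
    linarith
  rw [Finset.sum_union h, h1, hop_union h]
  linarith

/-- Extension by zero of a function on a finite subset of the lattice. -/
noncomputable def extZero {d : ℕ} {Λ : Finset (Fin d → ℤ)} (f : Λ → ℝ) (x : Fin d → ℤ) : ℝ :=
  if h : x ∈ Λ then f ⟨x, h⟩ else 0

lemma extZero_coe {d : ℕ} {Λ : Finset (Fin d → ℤ)} (f : Λ → ℝ) (x : Λ) :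
    extZero f x = f x := by
  simp [extZero]

lemma sum_extZero_sq {d : ℕ} {Λ : Finset (Fin d → ℤ)} {φ : Λ → Λ → ℝ} (hφ : IsOrthoArray φ)
    (i : Λ) : ∑ x ∈ Λ, extZero (φ i) x ^ 2 = 1 := by
  rw [← Finset.sum_coe_sort Λ fun x => extZero (φ i) x ^ 2]
  simp only [extZero_coe, sq]
  simpa using hφ i i

lemma sum_sq_extZero_le {d : ℕ} {A Λ : Finset (Fin d → ℤ)} (hA : A ⊆ Λ) {φ : Λ → Λ → ℝ}
    (hφ : IsOrthoArray φ) (s : Finset Λ) (u : (Fin d → ℤ) → ℝ) :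
    ∑ i ∈ s, (∑ x ∈ A, extZero (φ i) x * u x) ^ 2 ≤ ∑ x ∈ A, u x ^ 2 := by
  have h := hφ.sum_sq_le s fun x : Λ => if (x : Fin d → ℤ) ∈ A then u x else 0
  have hL : ∀ i, ∑ x : Λ, φ i x * (if (x : Fin d → ℤ) ∈ A then u x else 0)
      = ∑ x ∈ A, extZero (φ i) x * u x := by
    intro i
    simp only [← extZero_coe (φ i)]
    rw [Finset.sum_coe_sort Λ fun x => extZero (φ i) x * (if x ∈ A then u x else 0)]
    simp only [mul_ite, mul_zero]
    rw [Finset.sum_ite_mem, Finset.inter_eq_right.2 hA]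
  have hR : ∑ x : Λ, (if (x : Fin d → ℤ) ∈ A then u x else 0) ^ 2 = ∑ x ∈ A, u x ^ 2 := by
    rw [Finset.sum_coe_sort Λ fun x => (if x ∈ A then u x else 0) ^ 2]
    simp only [ite_pow, zero_pow two_ne_zero]
    rw [Finset.sum_ite_mem, Finset.inter_eq_right.2 hA]
  simpa only [hL, hR] using h

lemma eigenvalue_eq {d : ℕ} {Λ : Finset (Fin d → ℤ)} {V : (Fin d → ℤ) → ℝ} {φ : Λ → Λ → ℝ}
    {e : Λ → ℝ} (hφ : IsOrthoArray φ)
    (he : ∀ j x, ∑ y, hV d Λ V x y * φ j y = e j * φ j x) (i : Λ) :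
    e i = ∑ x ∈ Λ, V x * extZero (φ i) x ^ 2 - hop Λ Λ (extZero (φ i)) := by
  rw [← hV_quadForm]
  simp only [extZero_coe, he]
  calc e i = e i * ∑ x, φ i x * φ i x := by rw [hφ i i]; simp
    _ = _ := by
      rw [Finset.mul_sum]
      exact Finset.sum_congr rfl fun x _ => by ring

lemma abs_eigenvalue_le {d : ℕ} {A : Finset (Fin d → ℤ)} {φ : A → A → ℝ}
    {e : A → ℝ} (hφ : IsOrthoArray φ)
    (he : ∀ j x, ∑ y, hV d A (fun _ => 0) x y * φ j y = e j * φ j x) (i : A) :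
    |e i| ≤ 2 * d := by
  rw [eigenvalue_eq hφ he]
  have := abs_hop_le A (extZero (φ i))
  rw [sum_extZero_sq hφ] at this
  simpa using this

lemma neg_hop_eq_sum {d : ℕ} {A : Finset (Fin d → ℤ)} {ψ : A → A → ℝ}
    {e : A → ℝ} (hψ : IsOrthoArray ψ)
    (he : ∀ j x, ∑ y, hV d A (fun _ => 0) x y * ψ j y = e j * ψ j x) (f : (Fin d → ℤ) → ℝ) :
    -hop A A f = ∑ j, e j * (∑ x ∈ A, f x * extZero (ψ j) x) ^ 2 := by
  have h1 := hV_quadForm A (fun _ => 0) f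
  rw [quadForm_eq_sum hψ he fun x : A => f x] at h1
  simp only [zero_mul, Finset.sum_const_zero, zero_sub] at h1
  rw [← h1]
  refine Finset.sum_congr rfl fun j _ => ?_
  rw [← Finset.sum_coe_sort A fun x => f x * extZero (ψ j) x]
  simp only [extZero_coe, mul_comm]

lemma sum_hop_le_bdry {d : ℕ} {A W : Finset (Fin d → ℤ)} (h : Disjoint A W) :
    ∑ y ∈ W, ∑ x ∈ A, (if dist1 y x = 1 then (1 : ℝ) else 0)
      ≤ (bdry (A : Set (Fin d → ℤ)) : ℝ) := by
  rw [Finset.sum_comm, bdry_eq_sum, Nat.cast_sum]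
  refine Finset.sum_le_sum fun x _ => ?_
  simp only [dist1_comm _ x]
  rw [sum_neighbors W x fun _ => (1 : ℝ), outDeg, Finset.card_filter, Nat.cast_sum]
  refine Finset.sum_le_sum fun p _ => ?_
  by_cases hp : x + step p ∈ W
  · simp [hp, Finset.disjoint_right.1 h hp]
  · rw [if_neg hp]; positivity

/-- Comparison of the Hamiltonian with a high potential off `A` to the Dirichlet Hamiltonian
on `A`. -/
lemma exists_sum_dirichlet_le {d : ℕ} {A Λ : Finset (Fin d → ℤ)} (hA : A ⊆ Λ)
    {V : (Fin d → ℤ) → ℝ} {V0 : ℝ} (hVA : ∀ x ∈ A, V x = 0) (hVW : ∀ x ∈ Λ \ A, V0 ≤ V x)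
    (hV0 : 4 * (d : ℝ) < V0) {φ : Λ → Λ → ℝ} {e : Λ → ℝ} (hφ : IsOrthoArray φ)
    (he : ∀ j x, ∑ y, hV d Λ V x y * φ j y = e j * φ j x) {ψ : A → A → ℝ} {e' : A → ℝ}
    (hψ : IsOrthoArray ψ)
    (he' : ∀ j x, ∑ y, hV d A (fun _ => 0) x y * ψ j y = e' j * ψ j x)
    (s : Finset Λ) (hs : s.card ≤ A.card) :
    ∃ s' : Finset A, s'.card = s.card ∧
      ∑ j ∈ s', e' j ≤ ∑ i ∈ s, e i + bdry (A : Set (Fin d → ℤ)) / (V0 - 4 * d) := by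
  have hM : 0 < V0 - 4 * d := by linarith
  have hdisj : Disjoint A (Λ \ A) := Finset.disjoint_sdiff
  have hun : A ∪ (Λ \ A) = Λ := Finset.union_sdiff_of_subset hA
  set F : Λ → (Fin d → ℤ) → ℝ := fun i => extZero (φ i) with hF
  set g : A → ℝ := fun j => ∑ i ∈ s, (∑ x ∈ A, F i x * extZero (ψ j) x) ^ 2 with hg
  have hg1 : ∀ j, g j ≤ 1 := fun j =>
    (sum_sq_extZero_le hA hφ s (extZero (ψ j))).trans (sum_extZero_sq hψ j).le
  have hgsum : ∑ j, g j = ∑ i ∈ s, ∑ x ∈ A, F i x ^ 2 := by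
    rw [hg, Finset.sum_comm]
    refine Finset.sum_congr rfl fun i _ => ?_
    rw [← Finset.sum_coe_sort A fun x => F i x ^ 2, ← hψ.sum_sq fun x : A => F i x]
    refine Finset.sum_congr rfl fun j _ => ?_
    rw [← Finset.sum_coe_sort A fun x => F i x * extZero (ψ j) x]
    simp only [extZero_coe, mul_comm]
  have hnorm : ∀ i, ∑ x ∈ A, F i x ^ 2 + ∑ x ∈ Λ \ A, F i x ^ 2 = 1 := fun i => by
    rw [← Finset.sum_union hdisj, hun]; exact sum_extZero_sq hφ i
  have hWsum : ∑ i ∈ s, ∑ x ∈ Λ \ A, F i x ^ 2 = s.card - ∑ j, g j := by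
    rw [hgsum, eq_sub_iff_add_eq, ← Finset.sum_add_distrib]
    simp only [add_comm (∑ x ∈ Λ \ A, _), hnorm]
    simp
  have hgN : ∑ j, g j ≤ s.card := by
    have : 0 ≤ ∑ i ∈ s, ∑ x ∈ Λ \ A, F i x ^ 2 :=
      Finset.sum_nonneg fun i _ => Finset.sum_nonneg fun x _ => sq_nonneg _
    linarith
  obtain ⟨s', hs', hle⟩ := exists_card_eq_sum_mul_le (fun j => 2 * (d : ℝ) - e' j) g s.card
    (by simpa using hs)
    (fun j => by linarith [(abs_le.1 (abs_eigenvalue_le hψ he' j)).2])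
    (fun j => Finset.sum_nonneg fun i _ => sq_nonneg _) hg1 hgN
  refine ⟨s', hs', ?_⟩
  have hτ : ∑ i ∈ s, ∑ y ∈ Λ \ A, (∑ x ∈ A, if dist1 y x = 1 then F i x else 0) ^ 2
      ≤ bdry (A : Set (Fin d → ℤ)) := by
    refine le_trans ?_ (sum_hop_le_bdry hdisj)
    rw [Finset.sum_comm]
    refine Finset.sum_le_sum fun y _ => ?_
    have := sum_sq_extZero_le hA hφ s fun x => if dist1 y x = 1 then (1 : ℝ) else 0
    simpa using this
  have hmain : ∀ i, ∑ j, e' j * (∑ x ∈ A, F i x * extZero (ψ j) x) ^ 2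
      - (∑ y ∈ Λ \ A, (∑ x ∈ A, if dist1 y x = 1 then F i x else 0) ^ 2) / (V0 - 4 * d)
      + 2 * d * ∑ x ∈ Λ \ A, F i x ^ 2 ≤ e i := by
    intro i
    have := quadForm_lower_bound hdisj V (F i) hVA hVW hV0
    rw [hun, neg_hop_eq_sum hψ he'] at this
    rw [eigenvalue_eq hφ he i]
    exact this
  have hsum := Finset.sum_le_sum fun i (_ : i ∈ s) => hmain i
  rw [Finset.sum_add_distrib, Finset.sum_sub_distrib, ← Finset.mul_sum, ← Finset.sum_div, hWsum,
    Finset.sum_comm] at hsum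
  simp only [← Finset.mul_sum] at hsum
  have hτ' := div_le_div_of_nonneg_right hτ hM.le
  simp only [sub_mul, Finset.sum_sub_distrib, Finset.sum_const, nsmul_eq_mul, hs',
    ← Finset.mul_sum] at hle
  have : ∑ j, e' j * g j = ∑ j, e' j * ∑ i ∈ s, (∑ x ∈ A, F i x * extZero (ψ j) x) ^ 2 := rfl
  rw [← this] at hsum
  linarith

/-- The boundary source `∑_{y ∼ x, y ∉ A} e^{i k·y}` at the site `x`. -/
noncomputable def bsource {d : ℕ} (A : Finset (Fin d → ℤ)) (k : Fin d → ℝ) (x : Fin d → ℤ) : ℂ :=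
  ∑ p, if x + step p ∈ A then 0 else wave k (x + step p)

/-- The Fourier coefficient of the `j`-th basis function. -/
noncomputable def fcoef {d : ℕ} {A : Finset (Fin d → ℤ)} (φ : A → A → ℝ) (k : Fin d → ℝ)
    (j : A) : ℂ := ∑ x : A, (φ j x : ℂ) * wave k x

/-- The coefficient of the boundary source along the `j`-th basis function. -/
noncomputable def bcoef {d : ℕ} {A : Finset (Fin d → ℤ)} (φ : A → A → ℝ) (k : Fin d → ℝ)
    (j : A) : ℂ := ∑ x : A, (φ j x : ℂ) * bsource A k x

section Dirichlet

variable {d : ℕ} {A : Finset (Fin d → ℤ)} {φ : A → A → ℝ} {e : A → ℝ}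

lemma continuous_bsource (x : Fin d → ℤ) : Continuous fun k => bsource A k x := by
  unfold bsource
  refine continuous_finsetSum _ fun p _ => ?_
  split_ifs
  · exact continuous_const
  · exact continuous_wave _

lemma continuous_fcoef (φ : A → A → ℝ) (j : A) : Continuous fun k => fcoef φ k j := by
  unfold fcoef
  exact continuous_finsetSum _ fun x _ => continuous_const.mul (continuous_wave _)

lemma continuous_bcoef (φ : A → A → ℝ) (j : A) : Continuous fun k => bcoef φ k j := by
  unfold bcoef
  exact continuous_finsetSum _ fun x _ => continuous_const.mul (continuous_bsource _)

lemma continuous_conj_wave (x : Fin d → ℤ) :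
    Continuous fun k : Fin d → ℝ => (starRingEnd ℂ) (wave k x) :=
  Complex.continuous_conj.comp (continuous_wave x)

lemma hV_mulVec_wave (k : Fin d → ℝ) (x : A) :
    ∑ y : A, (hV d A (fun _ => 0) x y : ℂ) * wave k y = eps d k * wave k x + bsource A k x := by
  have h := hV_mulVec A (fun _ => 0) x (wave k)
  rw [sum_neighbors] at h
  simp only [Complex.real_smul, Complex.ofReal_zero, zero_mul, zero_sub] at h
  rw [h]
  have h2 : ∑ p, wave k ((x : Fin d → ℤ) + step p) = -(eps d k * wave k x) := by
    simp only [wave_add, ← Finset.mul_sum, sum_wave_step]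
    ring
  have h3 : ∑ p, (if (x : Fin d → ℤ) + step p ∈ A then wave k ((x : Fin d → ℤ) + step p) else 0)
      + bsource A k x = ∑ p, wave k ((x : Fin d → ℤ) + step p) := by
    unfold bsource
    rw [← Finset.sum_add_distrib]
    exact Finset.sum_congr rfl fun p _ => by split_ifs <;> simp
  rw [h2] at h3
  linear_combination -h3

lemma bcoef_eq (he : ∀ j x, ∑ y, hV d A (fun _ => 0) x y * φ j y = e j * φ j x)
    (k : Fin d → ℝ) (j : A) : bcoef φ k j = ((e j - eps d k : ℝ) : ℂ) * fcoef φ k j := by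
  have h1 : ∑ y : A, (φ j y : ℂ) * ∑ x : A, (hV d A (fun _ => 0) y x : ℂ) * wave k x
      = e j * fcoef φ k j := by
    unfold fcoef
    simp only [Finset.mul_sum]
    rw [Finset.sum_comm]
    refine Finset.sum_congr rfl fun x _ => ?_
    have := congrArg (fun r : ℝ => (r : ℂ) * wave k x) (he j x)
    simp only [Complex.ofReal_sum, Complex.ofReal_mul, Finset.sum_mul] at this
    rw [← mul_assoc, ← this]
    refine Finset.sum_congr rfl fun y _ => ?_
    have hs : hV d A (fun _ => 0) y x = hV d A (fun _ => 0) x y :=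
      (hV_isHermitian d A fun _ => 0).apply x y
    rw [hs]; ring
  simp only [hV_mulVec_wave, mul_add, Finset.sum_add_distrib] at h1
  have h2 : ∑ y : A, (φ j y : ℂ) * (eps d k * wave k y) = eps d k * fcoef φ k j := by
    unfold fcoef
    rw [Finset.mul_sum]
    exact Finset.sum_congr rfl fun x _ => by ring
  rw [h2] at h1
  unfold bcoef
  push_cast
  linear_combination h1

lemma norm_bcoef_sq_le (hφ : IsOrthoArray φ)
    (he : ∀ j x, ∑ y, hV d A (fun _ => 0) x y * φ j y = e j * φ j x)
    (k : Fin d → ℝ) (j : A) : ‖bcoef φ k j‖ ^ 2 ≤ 16 * d ^ 2 * ‖fcoef φ k j‖ ^ 2 := by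
  rw [bcoef_eq he, norm_mul, mul_pow, Complex.norm_real, Real.norm_eq_abs, sq_abs]
  refine mul_le_mul_of_nonneg_right ?_ (sq_nonneg _)
  have h1 := abs_le.1 (abs_eigenvalue_le hφ he j)
  have h2 := abs_le.1 (abs_eps_le d k)
  nlinarith

lemma integral_conj_wave_mul_wave (x y : Fin d → ℤ) :
    ∫ k, (starRingEnd ℂ) (wave k x) * wave k y ∂bz d = if x = y then 1 else 0 := by
  simp only [conj_wave_mul_wave, integral_wave, sub_eq_zero, eq_comm]

lemma integral_conj_wave_mul_bcoef (φ : A → A → ℝ) (x j : A) :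
    ∫ k, (starRingEnd ℂ) (wave k x) * bcoef φ k j ∂bz d = 0 := by
  have h1 : ∀ y : Fin d → ℤ, ∫ k, (starRingEnd ℂ) (wave k x) * bsource A k y ∂bz d = 0 := by
    intro y
    unfold bsource
    simp only [Finset.mul_sum]
    rw [integral_finsetSum]
    · refine Finset.sum_eq_zero fun p _ => ?_
      split_ifs with hp
      · simp
      · rw [integral_conj_wave_mul_wave, if_neg]
        rintro h
        exact hp (h ▸ x.2)
    · intro p _
      split_ifs
      · simp
      · exact integrable_bz ((continuous_conj_wave _).mul (continuous_wave _))
  unfold bcoef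
  simp only [Finset.mul_sum, mul_left_comm _ ((φ j _ : ℝ) : ℂ)]
  rw [integral_finsetSum]
  · exact Finset.sum_eq_zero fun y _ => by rw [integral_const_mul, h1, mul_zero]
  · intro y _
    exact (integrable_bz ((continuous_conj_wave _).mul (continuous_bsource _))).const_mul _

lemma integral_conj_wave_mul_fcoef (φ : A → A → ℝ) (x j : A) :
    ∫ k, (starRingEnd ℂ) (wave k x) * fcoef φ k j ∂bz d = φ j x := by
  unfold fcoef
  simp only [Finset.mul_sum, mul_left_comm _ ((φ j _ : ℝ) : ℂ)]
  rw [integral_finsetSum]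
  · simp only [integral_const_mul, integral_conj_wave_mul_wave, Subtype.coe_inj]
    simp
  · intro y _
    exact (integrable_bz ((continuous_conj_wave _).mul (continuous_wave _))).const_mul _

lemma integral_conj_fcoef_mul {f : (Fin d → ℝ) → ℂ} (hf : Continuous f) (j : A) :
    ∫ k, (starRingEnd ℂ) (fcoef φ k j) * f k ∂bz d
      = ∑ x : A, (φ j x : ℂ) * ∫ k, (starRingEnd ℂ) (wave k x) * f k ∂bz d := by
  unfold fcoef
  simp only [map_sum, map_mul, Complex.conj_ofReal, Finset.sum_mul, mul_assoc]
  rw [integral_finsetSum]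
  · simp only [integral_const_mul]
  · intro y _
    exact (integrable_bz ((continuous_conj_wave _).mul hf)).const_mul _

lemma integral_norm_fcoef_sq (hφ : IsOrthoArray φ) (j : A) :
    ∫ k, ‖fcoef φ k j‖ ^ 2 ∂bz d = 1 := by
  have h := integral_conj_fcoef_mul (φ := φ) (continuous_fcoef φ j) j
  simp only [integral_conj_wave_mul_fcoef, Complex.conj_mul'] at h
  have h2 := congrArg (fun r : ℝ => (r : ℂ)) (hφ j j)
  simp only [Complex.ofReal_sum, Complex.ofReal_mul] at h2
  rw [h2] at h
  simp only [← Complex.ofReal_pow, integral_complex_ofReal] at h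
  simpa using h

lemma integral_eps_mul_norm_fcoef_sq (hφ : IsOrthoArray φ)
    (he : ∀ j x, ∑ y, hV d A (fun _ => 0) x y * φ j y = e j * φ j x) (j : A) :
    ∫ k, eps d k * ‖fcoef φ k j‖ ^ 2 ∂bz d = e j := by
  have h := integral_conj_fcoef_mul (φ := φ) (continuous_bcoef φ j) j
  simp only [integral_conj_wave_mul_bcoef, mul_zero, Finset.sum_const_zero] at h
  have h2 : ∀ k, (starRingEnd ℂ) (fcoef φ k j) * bcoef φ k j
      = (((e j - eps d k) * ‖fcoef φ k j‖ ^ 2 : ℝ) : ℂ) := by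
    intro k
    rw [bcoef_eq he, mul_left_comm, Complex.conj_mul']
    push_cast; ring
  simp only [h2, integral_complex_ofReal] at h
  have h3 : ∫ k, (e j - eps d k) * ‖fcoef φ k j‖ ^ 2 ∂bz d = 0 := by exact_mod_cast h
  have hc : Continuous fun k => ‖fcoef φ k j‖ ^ 2 := (continuous_fcoef φ j).norm.pow 2
  simp only [sub_mul] at h3
  rw [integral_sub ((integrable_bz hc).const_mul _)
    (integrable_bz (f := fun k => eps d k * ‖fcoef φ k j‖ ^ 2) ((continuous_eps d).mul hc)), integral_const_mul,
    integral_norm_fcoef_sq hφ] at h3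
  linarith

lemma sum_norm_fcoef_sq (hφ : IsOrthoArray φ) (k : Fin d → ℝ) :
    ∑ j, ‖fcoef φ k j‖ ^ 2 = A.card := by
  unfold fcoef
  rw [hφ.sum_norm_sq fun x : A => wave k x]
  simp [norm_wave]

lemma norm_bsource_le (k : Fin d → ℝ) (x : Fin d → ℤ) : ‖bsource A k x‖ ≤ outDeg A x := by
  unfold bsource outDeg
  rw [Finset.card_filter, Nat.cast_sum]
  refine (norm_sum_le _ _).trans (Finset.sum_le_sum fun p _ => ?_)
  split_ifs <;> simp_all [norm_wave]

lemma sum_norm_bcoef_sq_le (hφ : IsOrthoArray φ) (k : Fin d → ℝ) :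
    ∑ j, ‖bcoef φ k j‖ ^ 2 ≤ 2 * d * bdry (A : Set (Fin d → ℤ)) := by
  unfold bcoef
  rw [hφ.sum_norm_sq fun x : A => bsource A k x,
    Finset.sum_coe_sort A fun x => ‖bsource A k x‖ ^ 2, bdry_eq_sum, Nat.cast_sum, Finset.mul_sum]
  refine Finset.sum_le_sum fun x _ => ?_
  have h1 := norm_bsource_le (A := A) k x
  have h2 : (outDeg A x : ℝ) ≤ 2 * d := by exact_mod_cast outDeg_le A x
  nlinarith [norm_nonneg (bsource A k x)]

end Dirichlet

lemma integrable_piecewise_bz {d : ℕ} (μ : ℝ) {f g : (Fin d → ℝ) → ℝ} (hf : Continuous f)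
    (hg : Continuous g) : Integrable ({k | eps d k < μ}.piecewise f g) (bz d) :=
  Integrable.piecewise (measurableSet_lt_eps d μ) (integrable_bz hf).integrableOn
    (integrable_bz hg).integrableOn

lemma integral_eps (d : ℕ) : ∫ k, eps d k ∂bz d = 0 := by
  have h : ∀ k, eps d k = -2 * ∑ i, (wave k (step (i, true))).re := fun k => by
    simp only [wave_step_re, eps]
  simp only [h]
  rw [integral_const_mul, integral_finsetSum]
  · simp only [integral_wave_re]
    rw [Finset.sum_eq_zero, mul_zero]
    intro i _
    rw [if_neg]
    intro h0
    have := congrFun h0 i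
    simp [step] at this
  · intro i _
    exact integrable_bz (Complex.continuous_re.comp (continuous_wave _))

lemma en_neg {d : ℕ} {μ : ℝ} (h0 : 0 < Rfun d μ) (h1 : Rfun d μ < 1) : en d μ < 0 := by
  rw [Rfun_eq] at h0 h1
  have hm := measurableSet_lt_eps d μ
  have hint : Integrable (eps d) (bz d) := integrable_bz (continuous_eps d)
  have hsum := integral_add_compl hm hint
  rw [integral_eps] at hsum
  have hpos : 0 < ∫ k in {k | eps d k < μ}, (μ - eps d k) ∂bz d := by
    rw [setIntegral_pos_iff_support_of_nonneg_ae]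
    · have hsupp : (Function.support fun k => μ - eps d k) ∩ {k | eps d k < μ}
          = {k | eps d k < μ} := by
        refine Set.inter_eq_right.2 fun k hk => ?_
        simp only [Function.mem_support]
        have : eps d k < μ := hk
        linarith
      rw [hsupp]
      exact (ENNReal.toReal_pos_iff.1 h0).1
    · filter_upwards [ae_restrict_mem hm] with k hk
      have : eps d k < μ := hk
      simp only [Pi.zero_apply]
      linarith
    · exact ((integrable_const _).sub hint).integrableOn
  have hnn : 0 ≤ ∫ k in {k | eps d k < μ}ᶜ, (eps d k - μ) ∂bz d := by
    refine setIntegral_nonneg hm.compl fun k hk => ?_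
    have : ¬ eps d k < μ := hk
    linarith
  rw [integral_sub (integrable_const _) hint.integrableOn, setIntegral_const, smul_eq_mul] at hpos
  rw [integral_sub hint.integrableOn (integrable_const _), setIntegral_const, smul_eq_mul,
    probReal_compl_eq_one_sub hm] at hnn
  rw [en_eq]
  nlinarith

lemma setIntegral_cos {d : ℕ} (μ : ℝ) (i : Fin d) :
    ∫ k in {k | eps d k < μ}, Real.cos (k i) ∂bz d = -en d μ / (2 * d) := by
  have hswap : ∀ j, ∫ k in {k | eps d k < μ}, Real.cos (k j) ∂bz d
      = ∫ k in {k | eps d k < μ}, Real.cos (k i) ∂bz d := by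
    intro j
    have hm := measurableSet_lt_eps d μ
    have hmp := volume_measurePreserving_piCongrLeft (fun _ : Fin d => ℝ) (Equiv.swap i j)
    have happ : ∀ (k : Fin d → ℝ) (l : Fin d),
        MeasurableEquiv.piCongrLeft (fun _ : Fin d => ℝ) (Equiv.swap i j) k l
          = k (Equiv.swap i j l) := by
      intro k l
      have := MeasurableEquiv.piCongrLeft_apply_apply (β := fun _ : Fin d => ℝ)
        (e := Equiv.swap i j) k (Equiv.swap i j l)
      simpa using this
    set T : Set (Fin d → ℝ) :=
      {k | eps d k < μ} ∩ {k : Fin d → ℝ | ∀ i, k i ∈ Set.Icc (-Real.pi) Real.pi} with hT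
    have hpre : MeasurableEquiv.piCongrLeft (fun _ : Fin d => ℝ) (Equiv.swap i j) ⁻¹' T = T := by
      ext k
      simp only [hT, Set.mem_preimage, Set.mem_inter_iff, Set.mem_ofPred_eq, happ, eps]
      rw [Equiv.sum_comp (Equiv.swap i j) fun l => Real.cos (k l)]
      refine and_congr_right fun _ => ?_
      exact ⟨fun h l => by simpa using h (Equiv.swap i j l), fun h l => h _⟩
    have hcalc := hmp.setIntegral_preimage_emb (MeasurableEquiv.measurableEmbedding _)
      (fun k => Real.cos (k i)) T
    rw [hpre] at hcalc
    simp only [happ, Equiv.swap_apply_left] at hcalc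
    unfold bz
    rw [Measure.restrict_smul, Measure.restrict_restrict hm, integral_smul_measure,
      integral_smul_measure, hcalc]
  have hd : (d : ℝ) ≠ 0 := by
    have := i.pos
    positivity
  have hsum : en d μ = -2 * ∑ j, ∫ k in {k | eps d k < μ}, Real.cos (k j) ∂bz d := by
    rw [en_eq, ← integral_finsetSum, ← integral_const_mul]
    · rfl
    · intro j _
      exact (integrable_bz (by fun_prop)).integrableOn
  simp only [hswap, Finset.sum_const, Finset.card_univ, Fintype.card_fin, nsmul_eq_mul] at hsum
  rw [hsum]
  field_simp

section Gap

variable {d : ℕ} {A : Finset (Fin d → ℤ)} {φ : A → A → ℝ} {e : A → ℝ}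

lemma continuous_sum_norm_fcoef_sq (φ : A → A → ℝ) (s : Finset A) :
    Continuous fun k => ∑ j ∈ s, ‖fcoef φ k j‖ ^ 2 :=
  continuous_finsetSum _ fun j _ => (continuous_fcoef φ j).norm.pow 2

lemma continuous_sum_norm_bcoef_sq (φ : A → A → ℝ) (s : Finset A) :
    Continuous fun k => ∑ j ∈ s, ‖bcoef φ k j‖ ^ 2 :=
  continuous_finsetSum _ fun j _ => (continuous_bcoef φ j).norm.pow 2

/-- The energy excess over the bulk energy, as an integral over momentum space. -/
lemma integral_excess (hφ : IsOrthoArray φ)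
    (he : ∀ j x, ∑ y, hV d A (fun _ => 0) x y * φ j y = e j * φ j x) (s : Finset A) {μ : ℝ}
    (hs : (s.card : ℝ) = Rfun d μ * A.card) :
    ∫ k, {k | eps d k < μ}.piecewise (fun k => (μ - eps d k) * ∑ j ∈ sᶜ, ‖fcoef φ k j‖ ^ 2)
        (fun k => (eps d k - μ) * ∑ j ∈ s, ‖fcoef φ k j‖ ^ 2) k ∂bz d
      = ∑ j ∈ s, e j - en d μ * A.card := by
  have hm := measurableSet_lt_eps d μ
  have hpt : ∀ k, {k | eps d k < μ}.piecewise
        (fun k => (μ - eps d k) * ∑ j ∈ sᶜ, ‖fcoef φ k j‖ ^ 2)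
        (fun k => (eps d k - μ) * ∑ j ∈ s, ‖fcoef φ k j‖ ^ 2) k
      = ∑ j ∈ s, (eps d k * ‖fcoef φ k j‖ ^ 2 - μ * ‖fcoef φ k j‖ ^ 2)
        - {k | eps d k < μ}.indicator (fun k => (eps d k - μ) * A.card) k := by
    intro k
    have h1 := Finset.sum_add_sum_compl s fun j => ‖fcoef φ k j‖ ^ 2
    rw [sum_norm_fcoef_sq hφ] at h1
    rw [Finset.sum_sub_distrib, ← Finset.mul_sum, ← Finset.mul_sum]
    by_cases hk : k ∈ {k | eps d k < μ}
    · rw [Set.piecewise_eq_of_mem _ _ _ hk, Set.indicator_of_mem hk, ← h1]; ring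
    · rw [Set.piecewise_eq_of_notMem _ _ _ hk, Set.indicator_of_notMem hk]; ring
  have hc : ∀ j, Integrable (fun k => ‖fcoef φ k j‖ ^ 2) (bz d) := fun j =>
    integrable_bz ((continuous_fcoef φ j).norm.pow 2)
  have hec : ∀ j, Integrable (fun k => eps d k * ‖fcoef φ k j‖ ^ 2) (bz d) := fun j =>
    integrable_bz ((continuous_eps d).mul ((continuous_fcoef φ j).norm.pow 2))
  have heps : Integrable (eps d) (bz d) := integrable_bz (continuous_eps d)
  have hbulk : Integrable (fun k => (eps d k - μ) * (A.card : ℝ)) (bz d) :=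
    (heps.sub (integrable_const μ)).mul_const _
  have hterm : ∀ j, Integrable
      (fun k => eps d k * ‖fcoef φ k j‖ ^ 2 - μ * ‖fcoef φ k j‖ ^ 2) (bz d) := fun j =>
    (hec j).sub ((hc j).const_mul μ)
  simp only [hpt]
  rw [integral_sub (integrable_finsetSum _ fun j _ => hterm j) (hbulk.indicator hm),
    integral_finsetSum _ fun j _ => hterm j,
    integral_indicator hm, integral_mul_const,
    integral_sub heps.integrableOn (integrable_const μ), setIntegral_const, ← en_eq, ← Rfun_eq]
  have hj : ∀ j, ∫ k, (eps d k * ‖fcoef φ k j‖ ^ 2 - μ * ‖fcoef φ k j‖ ^ 2) ∂bz d = e j - μ := by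
    intro j
    rw [integral_sub (hec j) ((hc j).const_mul μ), integral_const_mul,
      integral_eps_mul_norm_fcoef_sq hφ he, integral_norm_fcoef_sq hφ, mul_one]
  simp only [hj, Finset.sum_sub_distrib, Finset.sum_const, nsmul_eq_mul, smul_eq_mul, hs]
  ring

/-- The part of the boundary source at `x` spanned by the basis functions in `t`. -/
noncomputable def bproj (φ : A → A → ℝ) (t : Finset A) (k : Fin d → ℝ) (x : A) : ℂ :=
  ∑ j ∈ t, (φ j x : ℂ) * bcoef φ k j

lemma continuous_bproj (φ : A → A → ℝ) (t : Finset A) (x : A) :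
    Continuous fun k => bproj φ t k x := by
  unfold bproj
  exact continuous_finsetSum _ fun j _ => continuous_const.mul (continuous_bcoef φ j)

lemma sum_norm_bproj_sq (hφ : IsOrthoArray φ) (t : Finset A) (k : Fin d → ℝ) :
    ∑ x, ‖bproj φ t k x‖ ^ 2 = ∑ j ∈ t, ‖bcoef φ k j‖ ^ 2 := by
  have h := hφ.transpose.sum_norm_sq fun j => if j ∈ t then bcoef φ k j else 0
  simp only [mul_ite, mul_zero, Finset.sum_ite_mem, Finset.univ_inter] at h
  unfold bproj
  rw [h, ← Finset.univ_inter t, ← Finset.sum_ite_mem, Finset.univ_inter]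
  refine Finset.sum_congr rfl fun j _ => ?_
  split_ifs <;> simp

lemma bproj_add_bproj_compl (hφ : IsOrthoArray φ) (s : Finset A) (k : Fin d → ℝ) (x : A) :
    bproj φ s k x + bproj φ sᶜ k x = bsource A k x := by
  unfold bproj
  rw [Finset.sum_add_sum_compl]
  exact hφ.complex_sum_mul_sum (fun x : A => bsource A k x) x

lemma integral_conj_wave_mul_bproj (φ : A → A → ℝ) (t : Finset A) (x : A) :
    ∫ k, (starRingEnd ℂ) (wave k x) * bproj φ t k x ∂bz d = 0 := by
  unfold bproj
  simp only [Finset.mul_sum, mul_left_comm _ ((φ _ x : ℝ) : ℂ)]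
  rw [integral_finsetSum]
  · simp only [integral_const_mul, integral_conj_wave_mul_bcoef, mul_zero, Finset.sum_const_zero]
  · intro y _
    exact (integrable_bz ((continuous_conj_wave _).mul (continuous_bcoef _ _))).const_mul _

lemma setIntegral_conj_wave_mul_bsource_re (x : A) (μ : ℝ) :
    (∫ k in {k | eps d k < μ}, (starRingEnd ℂ) (wave k x) * bsource A k x ∂bz d).re
      = outDeg A x * (-en d μ / (2 * d)) := by
  have hint : IntegrableOn (fun k => (starRingEnd ℂ) (wave k x) * bsource A k x)
      {k | eps d k < μ} (bz d) := by
    have hcont : Continuous fun k => (starRingEnd ℂ) (wave k x) * bsource A k x :=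
      (continuous_conj_wave _).mul (continuous_bsource _)
    exact (integrable_bz hcont).integrableOn
  have h := integral_re (𝕜 := ℂ) hint
  simp only [RCLike.re_eq_complex_re] at h
  rw [← h]
  have hpt : ∀ k, ((starRingEnd ℂ) (wave k x) * bsource A k x).re
      = ∑ p ∈ Finset.univ.filter (fun p => (x : Fin d → ℤ) + step p ∉ A), Real.cos (k p.1) := by
    intro k
    unfold bsource
    rw [Finset.mul_sum, Complex.re_sum, Finset.sum_filter]
    refine Finset.sum_congr rfl fun p _ => ?_
    by_cases hp : (x : Fin d → ℤ) + step p ∈ A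
    · simp [hp]
    · rw [if_neg hp, if_pos hp, conj_wave_mul_wave, add_sub_cancel_left, wave_step_re]
  simp only [hpt]
  rw [integral_finsetSum]
  · simp only [setIntegral_cos, Finset.sum_const, nsmul_eq_mul, outDeg]
  · intro p _
    exact (integrable_bz (by fun_prop)).integrableOn

lemma outDeg_mul_le_integral (hφ : IsOrthoArray φ) (s : Finset A) (μ : ℝ) (x : A) :
    outDeg A x * (-en d μ / (2 * d)) ≤ ∫ k, {k | eps d k < μ}.piecewise
      (fun k => ‖bproj φ sᶜ k x‖) (fun k => ‖bproj φ s k x‖) k ∂bz d := by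
  have hm := measurableSet_lt_eps d μ
  have hint : ∀ t, Integrable (fun k => (starRingEnd ℂ) (wave k x) * bproj φ t k x) (bz d) :=
    fun t => integrable_bz ((continuous_conj_wave _).mul (continuous_bproj φ t x))
  have hn : ∀ t, Integrable (fun k => ‖bproj φ t k x‖) (bz d) :=
    fun t => integrable_bz (continuous_bproj φ t x).norm
  have hnorm : ∀ t (S : Set (Fin d → ℝ)),
      ‖∫ k in S, (starRingEnd ℂ) (wave k x) * bproj φ t k x ∂bz d‖
        ≤ ∫ k in S, ‖bproj φ t k x‖ ∂bz d := by
    intro t S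
    refine (norm_integral_le_integral_norm _).trans_eq ?_
    simp only [norm_mul, RCLike.norm_conj, norm_wave, one_mul]
  rw [← setIntegral_conj_wave_mul_bsource_re,
    integral_piecewise hm (hn _).integrableOn (hn _).integrableOn]
  have h0 := integral_add_compl hm (hint s)
  rw [integral_conj_wave_mul_bproj] at h0
  have hsplit : ∫ k in {k | eps d k < μ}, (starRingEnd ℂ) (wave k x) * bsource A k x ∂bz d
      = ∫ k in {k | eps d k < μ}, (starRingEnd ℂ) (wave k x) * bproj φ sᶜ k x ∂bz d
        - ∫ k in {k | eps d k < μ}ᶜ, (starRingEnd ℂ) (wave k x) * bproj φ s k x ∂bz d := by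
    simp only [← bproj_add_bproj_compl hφ s, mul_add]
    rw [integral_add (hint s).integrableOn (hint sᶜ).integrableOn]
    linear_combination h0
  refine (Complex.re_le_norm _).trans ?_
  rw [hsplit]
  exact (norm_sub_le _ _).trans (add_le_add (hnorm _ _) (hnorm _ _))

lemma sq_mul_bdry_le_integral (hφ : IsOrthoArray φ) (s : Finset A) {μ : ℝ} (hμ : en d μ < 0)
    (hd : 1 ≤ d) :
    (-en d μ / (2 * d)) ^ 2 * bdry (A : Set (Fin d → ℤ)) ≤ ∫ k, {k | eps d k < μ}.piecewise
      (fun k => ∑ j ∈ sᶜ, ‖bcoef φ k j‖ ^ 2) (fun k => ∑ j ∈ s, ‖bcoef φ k j‖ ^ 2) k ∂bz d := by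
  set κ := -en d μ / (2 * d) with hκ
  have hκ0 : 0 < κ := by
    have : (0 : ℝ) < d := by exact_mod_cast hd
    have h2 : 0 < -en d μ := by linarith
    positivity
  set H : A → (Fin d → ℝ) → ℝ := fun x => {k | eps d k < μ}.piecewise
      (fun k => ‖bproj φ sᶜ k x‖) (fun k => ‖bproj φ s k x‖) with hH
  have hHint : ∀ x, Integrable (H x) (bz d) := fun x =>
    integrable_piecewise_bz μ (continuous_bproj φ _ x).norm (continuous_bproj φ _ x).norm
  have hHsq : ∀ x k, H x k ^ 2 = {k | eps d k < μ}.piecewise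
      (fun k => ‖bproj φ sᶜ k x‖ ^ 2) (fun k => ‖bproj φ s k x‖ ^ 2) k := by
    intro x k
    by_cases hk : k ∈ {k | eps d k < μ}
    · simp only [hH, Set.piecewise_eq_of_mem _ _ _ hk]
    · simp only [hH, Set.piecewise_eq_of_notMem _ _ _ hk]
  have hHint2 : ∀ x, Integrable (fun k => H x k ^ 2) (bz d) := fun x => by
    simp only [hHsq]
    exact integrable_piecewise_bz μ ((continuous_bproj φ _ x).norm.pow 2)
      ((continuous_bproj φ _ x).norm.pow 2)
  have hx : ∀ x : A, κ ^ 2 * outDeg A x ≤ ∫ k, H x k ^ 2 ∂bz d := by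
    intro x
    rcases Nat.eq_zero_or_pos (outDeg A x) with h0 | h0
    · rw [h0]; simpa using integral_nonneg fun k => sq_nonneg (H x k)
    · have h1 : (1 : ℝ) ≤ outDeg A x := by exact_mod_cast h0
      have h2 : outDeg A x * κ ≤ ∫ k, H x k ∂bz d := outDeg_mul_le_integral hφ s μ x
      have h3 : ∫ k, (2 * κ * H x k - κ ^ 2) ∂bz d ≤ ∫ k, H x k ^ 2 ∂bz d := by
        refine integral_mono (((hHint x).const_mul _).sub (integrable_const _)) (hHint2 x) fun k => ?_
        nlinarith [sq_nonneg (H x k - κ)]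
      rw [integral_sub ((hHint x).const_mul _) (integrable_const _), integral_const_mul] at h3
      simp only [integral_const, probReal_univ, one_smul] at h3
      nlinarith
  have hsum := Finset.sum_le_sum fun x (_ : x ∈ (Finset.univ : Finset A)) => hx x
  rw [← Finset.mul_sum, Finset.sum_coe_sort A fun x => (outDeg A x : ℝ), ← Nat.cast_sum,
    ← bdry_eq_sum, ← integral_finsetSum _ fun x _ => hHint2 x] at hsum
  refine hsum.trans_eq (integral_congr_ae (Filter.Eventually.of_forall fun k => ?_))
  simp only [hHsq]
  by_cases hk : k ∈ {k | eps d k < μ}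
  · simp only [Set.piecewise_eq_of_mem _ _ _ hk, sum_norm_bproj_sq hφ]
  · simp only [Set.piecewise_eq_of_notMem _ _ _ hk, sum_norm_bproj_sq hφ]

/-- Quantitative surplus of the Dirichlet energy over the bulk energy. -/
lemma bdry_le_excess (hφ : IsOrthoArray φ)
    (he : ∀ j x, ∑ y, hV d A (fun _ => 0) x y * φ j y = e j * φ j x) (s : Finset A) {μ δ : ℝ}
    (hs : (s.card : ℝ) = Rfun d μ * A.card) (hμ : en d μ < 0) (hd : 1 ≤ d) (hδ : 0 < δ)
    (hδm : 4 * d * (bz d).real {k | |eps d k - μ| < δ} ≤ (-en d μ / (2 * d)) ^ 2) :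
    en d μ * A.card + (-en d μ / (2 * d)) ^ 2 * δ / (32 * d ^ 2) * bdry (A : Set (Fin d → ℤ))
      ≤ ∑ j ∈ s, e j := by
  have hd0 : (0 : ℝ) < d := by exact_mod_cast hd
  have hD : MeasurableSet {k | |eps d k - μ| < δ} :=
    measurableSet_lt ((continuous_eps d).sub continuous_const).abs.measurable measurable_const
  set B : ℝ := (bdry (A : Set (Fin d → ℤ)) : ℝ) with hB
  have hB0 : 0 ≤ B := Nat.cast_nonneg _
  set κ := -en d μ / (2 * d)
  have h1 : κ ^ 2 * B ≤ _ := sq_mul_bdry_le_integral hφ s hμ hd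
  have h2 := integral_excess hφ he s hs
  set G := {k | eps d k < μ}.piecewise (fun k => (μ - eps d k) * ∑ j ∈ sᶜ, ‖fcoef φ k j‖ ^ 2)
        (fun k => (eps d k - μ) * ∑ j ∈ s, ‖fcoef φ k j‖ ^ 2) with hG
  have hGint : Integrable G (bz d) := integrable_piecewise_bz μ
    ((continuous_const.sub (continuous_eps d)).mul (continuous_sum_norm_fcoef_sq φ _))
    (((continuous_eps d).sub continuous_const).mul (continuous_sum_norm_fcoef_sq φ _))
  have hpt : ∀ (t : Finset A) (k : Fin d → ℝ) (w : ℝ), 0 ≤ w → w = |eps d k - μ| →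
      ∑ j ∈ t, ‖bcoef φ k j‖ ^ 2 ≤ 16 * d ^ 2 / δ * (w * ∑ j ∈ t, ‖fcoef φ k j‖ ^ 2)
        + {k | |eps d k - μ| < δ}.indicator (fun _ => 2 * d * B) k := by
    intro t k w hw hwe
    have hc : 0 ≤ ∑ j ∈ t, ‖fcoef φ k j‖ ^ 2 := Finset.sum_nonneg fun _ _ => sq_nonneg _
    by_cases hk : k ∈ {k | |eps d k - μ| < δ}
    · rw [Set.indicator_of_mem hk]
      have : ∑ j ∈ t, ‖bcoef φ k j‖ ^ 2 ≤ 2 * d * B :=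
        (Finset.sum_le_sum_of_subset_of_nonneg (Finset.subset_univ _)
          fun _ _ _ => sq_nonneg _).trans (sum_norm_bcoef_sq_le hφ k)
      have h3 : 0 ≤ 16 * d ^ 2 / δ * (w * ∑ j ∈ t, ‖fcoef φ k j‖ ^ 2) := by positivity
      linarith
    · rw [Set.indicator_of_notMem hk, add_zero]
      have hδw : δ ≤ w := by rw [hwe]; exact not_lt.1 hk
      have h3 : ∑ j ∈ t, ‖bcoef φ k j‖ ^ 2 ≤ 16 * d ^ 2 * ∑ j ∈ t, ‖fcoef φ k j‖ ^ 2 := by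
        rw [Finset.mul_sum]
        exact Finset.sum_le_sum fun j _ => norm_bcoef_sq_le hφ he k j
      refine h3.trans ?_
      rw [div_mul_eq_mul_div, le_div_iff₀ hδ]
      have := mul_le_mul_of_nonneg_right hδw hc
      have h4 : (0 : ℝ) ≤ 16 * d ^ 2 := by positivity
      nlinarith [mul_le_mul_of_nonneg_left this h4]
  have h3 : κ ^ 2 * B ≤ ∫ k, (16 * d ^ 2 / δ * G k
      + {k | |eps d k - μ| < δ}.indicator (fun _ => 2 * d * B) k) ∂bz d := by
    refine h1.trans (integral_mono (integrable_piecewise_bz μ (continuous_sum_norm_bcoef_sq φ _)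
      (continuous_sum_norm_bcoef_sq φ _))
      ((hGint.const_mul _).add ((integrable_const _).indicator hD)) fun k => ?_)
    by_cases hk : k ∈ {k | eps d k < μ}
    · have hk' : eps d k < μ := hk
      simp only [hG, Set.piecewise_eq_of_mem _ _ _ hk]
      exact hpt sᶜ k _ (by linarith) (by rw [abs_of_neg (by linarith)]; ring)
    · have hk' : ¬ eps d k < μ := hk
      simp only [hG, Set.piecewise_eq_of_notMem _ _ _ hk]
      exact hpt s k _ (by linarith) (by rw [abs_of_nonneg (by linarith)])
  rw [integral_add (hGint.const_mul _) ((integrable_const _).indicator hD), integral_const_mul,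
    h2, integral_indicator hD, setIntegral_const, smul_eq_mul] at h3
  have h4 : (bz d).real {k | |eps d k - μ| < δ} * (2 * d * B) ≤ κ ^ 2 / 2 * B := by
    nlinarith
  have h5 : κ ^ 2 / 2 * B ≤ 16 * d ^ 2 / δ * (∑ j ∈ s, e j - en d μ * A.card) := by linarith
  rw [div_mul_eq_mul_div (16 * (d : ℝ) ^ 2), le_div_iff₀ hδ] at h5
  have h6 : κ ^ 2 * δ / (32 * d ^ 2) * B ≤ ∑ j ∈ s, e j - en d μ * A.card := by
    rw [div_mul_eq_mul_div, div_le_iff₀ (by positivity)]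
    linarith
  linarith

end Gap

/-- Level sets of the dispersion relation at attained filling levels are null. -/
lemma measure_level_eq_zero {d : ℕ} {μ : ℝ} (h1 : Rfun d μ < 1)
    (hsurj : ∀ ρ ∈ Set.Ioo (Rfun d μ) 1, ∃ E, Rfun d E = ρ) :
    (bz d) {k | eps d k = μ} = 0 := by
  by_contra h0
  set m := (bz d).real {k | eps d k = μ} with hm
  have hm0 : 0 < m := ENNReal.toReal_pos h0 (measure_ne_top _ _)
  obtain ⟨ρ, hρ1, hρ2⟩ := exists_between (lt_min (lt_add_of_pos_right (Rfun d μ) hm0) h1)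
  obtain ⟨E, hE⟩ := hsurj ρ ⟨hρ1, hρ2.trans_le (min_le_right _ _)⟩
  rw [Rfun_eq] at hE hρ1 hρ2
  rcases le_or_gt E μ with hle | hlt
  · have : (bz d).real {k | eps d k < E} ≤ (bz d).real {k | eps d k < μ} :=
      measureReal_mono fun k hk => lt_of_lt_of_le hk hle
    linarith
  · have hdisj : Disjoint {k | eps d k < μ} {k | eps d k = μ} :=
      Set.disjoint_left.2 fun k hk hk2 => by
        have h3 : eps d k < μ := hk
        have h4 : eps d k = μ := hk2
        linarith
    have hun := measureReal_union (μ := bz d) hdisj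
      (measurableSet_eq_fun (continuous_eps d).measurable measurable_const)
    have : (bz d).real ({k | eps d k < μ} ∪ {k | eps d k = μ}) ≤ (bz d).real {k | eps d k < E} := by
      refine measureReal_mono ?_
      rintro k (hk | hk)
      · exact lt_trans hk hlt
      · exact (show eps d k = μ from hk).trans_lt hlt
    have := hρ2.trans_le (min_le_left _ _)
    linarith

lemma exists_shell_measure_lt {d : ℕ} {μ : ℝ} (h0 : (bz d) {k | eps d k = μ} = 0) {r : ℝ}
    (hr : 0 < r) : ∃ δ > 0, (bz d).real {k | |eps d k - μ| < δ} < r := by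
  set S : ℕ → Set (Fin d → ℝ) := fun n => {k | |eps d k - μ| < 1 / ((n : ℝ) + 1)} with hS
  have hSm : ∀ n, MeasurableSet (S n) := fun n =>
    measurableSet_lt ((continuous_eps d).sub continuous_const).abs.measurable measurable_const
  have hanti : Antitone S := fun m n hmn k hk =>
    show |eps d k - μ| < 1 / ((m : ℝ) + 1) from
      (show |eps d k - μ| < 1 / ((n : ℝ) + 1) from hk).trans_le (Nat.one_div_le_one_div hmn)
  have hInter : ⋂ n, S n = {k | eps d k = μ} := by
    ext k
    simp only [hS, Set.mem_iInter, Set.mem_ofPred_eq]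
    constructor
    · intro h
      by_contra hne
      obtain ⟨n, hn⟩ := exists_nat_one_div_lt (abs_pos.2 (sub_ne_zero.2 hne))
      exact absurd (h n) (not_lt.2 hn.le)
    · intro h n
      rw [h, sub_self, abs_zero]
      exact Nat.one_div_pos_of_nat
  have ht := tendsto_measure_iInter_atTop (μ := bz d) (fun n => (hSm n).nullMeasurableSet) hanti
    ⟨0, measure_ne_top _ _⟩
  rw [hInter, h0] at ht
  obtain ⟨n, hn⟩ := (ht.eventually_lt_const (ENNReal.ofReal_pos.2 hr)).exists
  exact ⟨1 / ((n : ℝ) + 1), Nat.one_div_pos_of_nat,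
    (ENNReal.lt_ofReal_iff_toReal_lt (measure_ne_top _ _)).1 hn⟩

lemma exists_surplus {d : ℕ} (hd : 1 ≤ d) {μ : ℝ} (h0 : 0 < Rfun d μ) (h1 : Rfun d μ < 1)
    (hsurj : ∀ ρ ∈ Set.Ioo (Rfun d μ) 1, ∃ E, Rfun d E = ρ) :
    ∃ a > 0, ∀ (A : Finset (Fin d → ℤ)) (φ : A → A → ℝ) (e : A → ℝ), IsOrthoArray φ →
      (∀ j x, ∑ y, hV d A (fun _ => 0) x y * φ j y = e j * φ j x) →
      ∀ s : Finset A, (s.card : ℝ) = Rfun d μ * A.card →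
        en d μ * A.card + a * bdry (A : Set (Fin d → ℤ)) ≤ ∑ j ∈ s, e j := by
  have hen := en_neg h0 h1
  have hd0 : (0 : ℝ) < d := by exact_mod_cast hd
  have hκ : 0 < (-en d μ / (2 * d)) ^ 2 := by
    have : 0 < -en d μ := by linarith
    positivity
  obtain ⟨δ, hδ, hlt⟩ := exists_shell_measure_lt (measure_level_eq_zero h1 hsurj)
    (r := (-en d μ / (2 * d)) ^ 2 / (4 * d)) (by positivity)
  rw [lt_div_iff₀ (by positivity), mul_comm] at hlt
  exact ⟨(-en d μ / (2 * d)) ^ 2 * δ / (32 * d ^ 2), by positivity,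
    fun A φ e hφ he s hs => bdry_le_excess hφ he s hs hen hd hδ hlt.le⟩

lemma sum_dirichlet_eigenvalues {d : ℕ} {A : Finset (Fin d → ℤ)} {φ : A → A → ℝ} {e : A → ℝ}
    (hφ : IsOrthoArray φ)
    (he : ∀ j x, ∑ y, hV d A (fun _ => 0) x y * φ j y = e j * φ j x) : ∑ j, e j = 0 := by
  have h : ∀ j, e j = ∑ x, ∑ y, hV d A (fun _ => 0) x y * (φ j x * φ j y) := by
    intro j
    have h1 : ∑ x, φ j x * φ j x = 1 := by simpa using hφ j j
    calc e j = ∑ x, φ j x * (e j * φ j x) := by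
          simp only [mul_left_comm _ (e j)]
          rw [← Finset.mul_sum, h1, mul_one]
      _ = _ := by
          refine Finset.sum_congr rfl fun x _ => ?_
          rw [← he, Finset.mul_sum]
          exact Finset.sum_congr rfl fun y _ => by ring
  simp only [h]
  rw [Finset.sum_comm]
  refine Finset.sum_eq_zero fun x _ => ?_
  rw [Finset.sum_comm]
  refine Finset.sum_eq_zero fun y _ => ?_
  rw [← Finset.mul_sum]
  have h2 : ∑ j, φ j x * φ j y = if x = y then 1 else 0 := hφ.transpose x y
  rw [h2]
  split_ifs with hxy
  · subst hxy
    simp [hV, dist1]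
  · simp

lemma inv_le_gam {d : ℕ} (hd : 1 ≤ d) {V0 : ℝ} (hV0 : 2 * (d : ℝ) * (Real.sqrt d + 1) < V0) :
    4 * (d : ℝ) < V0 ∧ 1 / (V0 - 4 * d) ≤ gam d V0 := by
  have hd1 : (1 : ℝ) ≤ d := by exact_mod_cast hd
  have hs1 : 1 ≤ Real.sqrt d := Real.one_le_sqrt.2 hd1
  have hsq : Real.sqrt d ^ 2 = d := Real.sq_sqrt (by linarith)
  have h4 : 4 * (d : ℝ) < V0 := by nlinarith
  refine ⟨h4, ?_⟩
  obtain ⟨D, rfl⟩ : ∃ D, V0 = D + 2 * d := ⟨V0 - 2 * d, by ring⟩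
  have hD : 2 * (d : ℝ) * Real.sqrt d < D := by linarith
  have hD2 : 2 * (d : ℝ) < D := by linarith
  have hDD : 4 * (d : ℝ) ^ 3 < D ^ 2 := by
    have : (2 * (d : ℝ) * Real.sqrt d) ^ 2 < D ^ 2 :=
      pow_lt_pow_left₀ hD (by positivity) two_ne_zero
    calc 4 * (d : ℝ) ^ 3 = (2 * (d : ℝ) * Real.sqrt d) ^ 2 := by rw [mul_pow, hsq]; ring
      _ < D ^ 2 := this
  have hd3 : (d : ℝ) ^ 2 ≤ (d : ℝ) ^ 3 := pow_le_pow_right₀ hd1 (by norm_num)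
  unfold gam
  have e1 : D + 2 * (d : ℝ) - 4 * d = D - 2 * d := by ring
  have e2 : D + 2 * (d : ℝ) - 2 * d = D := by ring
  rw [e1, e2]
  have hsub : 0 < D - 2 * d := by linarith
  have hfac : (0 : ℝ) < D ^ 2 - 4 * d ^ 2 := by nlinarith
  have hle : 16 * (d : ℝ) ^ 3 / (D ^ 2 - 4 * d ^ 2) ≤ 16 * (d : ℝ) ^ 3 / (D ^ 2 - 4 * d ^ 3) :=
    div_le_div_of_nonneg_left (by positivity) (by linarith) (by linarith)
  refine le_trans ?_ (add_le_add_right hle _)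
  have hD0 : 0 < D := by linarith
  rw [div_add_div _ _ hD0.ne' hfac.ne', div_le_div_iff₀ hsub (by positivity)]
  have hcore : D * (D + 2 * d) ≤ 4 * d * (D ^ 2 - 4 * d ^ 2) + D * (16 * d ^ 3) := by
    have hd1' : (1 : ℝ) ≤ d ^ 2 := one_le_pow₀ hd1
    have i1 : D ^ 2 ≤ d * D ^ 2 := le_mul_of_one_le_left (sq_nonneg _) hd1
    have i2 : (d : ℝ) ≤ d ^ 3 := le_self_pow₀ hd1 (by norm_num)
    have i3 : d * D ≤ d ^ 3 * D := mul_le_mul_of_nonneg_right i2 hD0.le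
    have i4 : (d : ℝ) ^ 3 * 2 ≤ d ^ 3 * D :=
      mul_le_mul_of_nonneg_left (by linarith) (by positivity)
    have i5 : 0 ≤ d * D ^ 2 := by positivity
    have i6 : 0 ≤ d * D := by positivity
    nlinarith
  calc 1 * (D * (D ^ 2 - 4 * (d : ℝ) ^ 2)) = D * (D + 2 * d) * (D - 2 * d) := by ring
    _ ≤ _ := mul_le_mul_of_nonneg_right hcore hsub.le

/-- Lower bound for one spin species, given a surplus estimate for Dirichlet eigenvalue sums. -/
lemma le_SN {d : ℕ} (hd : 1 ≤ d) {Λ : Finset (Fin d → ℤ)} {V : (Fin d → ℤ) → ℝ} {V0 E : ℝ}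
    (hgap : ∀ x ∈ Λ, V x ≠ 0 → V0 ≤ V x) (hV0 : 2 * (d : ℝ) * (Real.sqrt d + 1) < V0) {N : ℕ}
    (hN : N ≤ (Aset d Λ V).card)
    (hE : ∀ (φ : Aset d Λ V → Aset d Λ V → ℝ) (e : Aset d Λ V → ℝ), IsOrthoArray φ →
      (∀ j x, ∑ y, hV d (Aset d Λ V) (fun _ => 0) x y * φ j y = e j * φ j x) →
      ∀ s : Finset (Aset d Λ V), s.card = N → E ≤ ∑ j ∈ s, e j) :
    E - gam d V0 * bdry (Aset d Λ V : Set (Fin d → ℤ)) ≤ SN d Λ V N := by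
  have hsub : Aset d Λ V ⊆ Λ := Finset.filter_subset _ _
  obtain ⟨h4, hgam⟩ := inv_le_gam hd hV0
  have hH := hV_isHermitian d Λ V
  obtain ⟨φ, hφ, he⟩ := exists_eigen_array hH
  obtain ⟨ψ, hψ, he'⟩ := exists_eigen_array (hV_isHermitian d (Aset d Λ V) fun _ => 0)
  unfold SN sumSmallest
  rw [dif_pos hH]
  refine le_csInf (Set.Nonempty.image _ ?_) ?_
  · obtain ⟨s, -, hs⟩ := Finset.exists_subset_card_eq (s := (Finset.univ : Finset Λ)) (n := N) (by
      rw [Finset.card_univ, Fintype.card_coe]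
      exact hN.trans (Finset.card_le_card hsub))
    exact ⟨s, hs⟩
  · rintro _ ⟨s, hs, rfl⟩
    have hs : s.card = N := hs
    obtain ⟨t, ht, hle⟩ := exists_sum_dirichlet_le hsub (V0 := V0)
      (fun x hx => (Finset.mem_filter.1 hx).2) (fun x hx => by
        rw [Finset.mem_sdiff] at hx
        exact hgap x hx.1 fun h0 => hx.2 (Finset.mem_filter.2 ⟨hx.1, h0⟩)) h4 hφ he hψ he' s
      (hs.trans_le hN)
    have h1 := hE ψ _ hψ he' t (ht.trans hs)
    have h2 := mul_le_mul_of_nonneg_right hgam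
      (Nat.cast_nonneg (α := ℝ) (bdry (Aset d Λ V : Set (Fin d → ℤ))))
    rw [one_div, inv_mul_eq_div] at h2
    simp only
    linarith

/-- Lower bound of Proposition 1 (non-interacting form): there is a function
`α : [0,1] → [0,∞)`, depending only on `d` and strictly positive on `(0,1)`,
such that for every magnetic potential with `A_↑ ∩ A_↓ = ∅` and gap
`V₀ > 2d(√d + 1)`,
`S_{N↑}(h_{V↑}) + S_{N↓}(h_{V↓}) ≥ Σ_σ [e(ρ_σ)|A_σ| + (α(ρ_σ) - γ(V₀))·B(A_σ)]`. -/
theorem stmt13 (d : ℕ) (hd : 1 ≤ d) (εF e : ℝ → ℝ)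
    (hεF : ∀ ρ ∈ Set.Ioo (0:ℝ) 1,
      εF ρ ∈ Set.Ioo (-(2*(d:ℝ))) (2*(d:ℝ)) ∧ Rfun d (εF ρ) = ρ)
    (he : ∀ ρ ∈ Set.Ioo (0:ℝ) 1, e ρ = en d (εF ρ))
    (he0 : e 0 = 0) (he1 : e 1 = 0) :
    ∃ α : ℝ → ℝ, (∀ ρ ∈ Set.Icc (0:ℝ) 1, 0 ≤ α ρ) ∧
      (∀ ρ ∈ Set.Ioo (0:ℝ) 1, 0 < α ρ) ∧
      ∀ (Λ : Finset (Fin d → ℤ)) (Vup Vdn : (Fin d → ℤ) → ℝ),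
        (∀ x ∈ Λ, 0 ≤ Vup x) → (∀ x ∈ Λ, 0 ≤ Vdn x) →
        Aset d Λ Vup ∩ Aset d Λ Vdn = ∅ →
        (Aset d Λ Vup).Nonempty → (Aset d Λ Vdn).Nonempty →
        ∀ V0 : ℝ,
        (∀ x ∈ Λ, (Vup x ≠ 0 → V0 ≤ Vup x) ∧ (Vdn x ≠ 0 → V0 ≤ Vdn x)) →
        2*(d:ℝ)*(Real.sqrt d + 1) < V0 →
        ∀ Nup Ndn : ℕ,
        Nup ≤ (Aset d Λ Vup).card → Ndn ≤ (Aset d Λ Vdn).card →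
        SN d Λ Vup Nup + SN d Λ Vdn Ndn ≥
          (e ((Nup:ℝ)/((Aset d Λ Vup).card : ℝ)) * ((Aset d Λ Vup).card : ℝ)
            + (α ((Nup:ℝ)/((Aset d Λ Vup).card : ℝ)) - gam d V0)
                * (bdry (↑(Aset d Λ Vup) : Set (Fin d → ℤ)) : ℝ))
          + (e ((Ndn:ℝ)/((Aset d Λ Vdn).card : ℝ)) * ((Aset d Λ Vdn).card : ℝ)
            + (α ((Ndn:ℝ)/((Aset d Λ Vdn).card : ℝ)) - gam d V0)
                * (bdry (↑(Aset d Λ Vdn) : Set (Fin d → ℤ)) : ℝ)) := by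
  have hα : ∀ ρ, ∃ a : ℝ, 0 ≤ a ∧ (ρ ∈ Set.Ioo (0 : ℝ) 1 → 0 < a) ∧ (ρ ∈ Set.Icc (0 : ℝ) 1 →
      ∀ (A : Finset (Fin d → ℤ)) (φ : A → A → ℝ) (ev : A → ℝ), IsOrthoArray φ →
      (∀ j x, ∑ y, hV d A (fun _ => 0) x y * φ j y = ev j * φ j x) →
      ∀ s : Finset A, (s.card : ℝ) = ρ * A.card →
        e ρ * A.card + a * bdry (A : Set (Fin d → ℤ)) ≤ ∑ j ∈ s, ev j) := by
    intro ρ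
    by_cases hρ : ρ ∈ Set.Ioo (0 : ℝ) 1
    · obtain ⟨-, hR⟩ := hεF ρ hρ
      obtain ⟨a, ha, h⟩ := exists_surplus hd (hR.symm ▸ hρ.1) (hR.symm ▸ hρ.2)
        fun r hr => ⟨εF r, (hεF r ⟨hρ.1.trans (hR ▸ hr.1), hr.2⟩).2⟩
      rw [hR, ← he ρ hρ] at h
      exact ⟨a, ha.le, fun _ => ha, fun _ => h⟩
    · refine ⟨0, le_rfl, fun h => absurd h hρ, fun hI A φ ev hφ hev s hs => ?_⟩
      rcases eq_or_lt_of_le hI.1 with h0 | h0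
      · subst h0
        have hs0 : s = ∅ := by simpa using hs
        simp [hs0, he0]
      · have h1 : ρ = 1 := le_antisymm hI.2 (not_lt.1 fun h => hρ ⟨h0, h⟩)
        subst h1
        have hsu : s = Finset.univ := by
          rw [← Finset.card_eq_iff_eq_univ, Fintype.card_coe]
          exact_mod_cast hs.trans (one_mul _)
        rw [hsu, sum_dirichlet_eigenvalues hφ hev, he1]
        simp
  choose α hα0 hαpos hαle using hα
  refine ⟨α, fun ρ _ => hα0 ρ, hαpos, ?_⟩
  intro Λ Vup Vdn _ _ _ hup hdn V0 hgap hV0 Nup Ndn hNup hNdn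
  have hspin : ∀ (V : (Fin d → ℤ) → ℝ) (N : ℕ), (∀ x ∈ Λ, V x ≠ 0 → V0 ≤ V x) →
      (Aset d Λ V).Nonempty → N ≤ (Aset d Λ V).card →
      e ((N : ℝ) / (Aset d Λ V).card) * (Aset d Λ V).card
        + (α ((N : ℝ) / (Aset d Λ V).card) - gam d V0)
          * bdry (Aset d Λ V : Set (Fin d → ℤ)) ≤ SN d Λ V N := by
    intro V N hV hne hN
    have hc : (0 : ℝ) < (Aset d Λ V).card := by exact_mod_cast hne.card_pos
    have hN' : (N : ℝ) ≤ (Aset d Λ V).card := by exact_mod_cast hN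
    refine le_trans (le_of_eq ?_) (le_SN hd hV hV0 hN fun φ ev hφ hev s hs =>
      hαle ((N : ℝ) / (Aset d Λ V).card) ⟨by positivity, (div_le_one hc).2 hN'⟩ _ φ ev hφ hev s ?_)
    · ring
    · rw [hs, div_mul_cancel₀ _ hc.ne']
  exact add_le_add (hspin Vup Nup (fun x hx => (hgap x hx).1) hup hNup)
    (hspin Vdn Ndn (fun x hx => (hgap x hx).2) hdn hNdn)
end

section
/- (Proposition 2, non-interacting form.) Let d ≥ 1, let Λ ⊆ ℤ^d be finite, and let V^↑, V^↓ : Λ → [0,∞) be a magnetic potential with A_↑ ∩ A_↓ = ∅, A_↑ and A_↓ nonempty, and V₀ > 2d(√d + 1). Let N_↑, N_↓ be integers with 0 ≤ N_σ ≤ |A_σ|. Let (φ^↑_1, …, φ^↑_{N↑}) and (φ^↓_1, …, φ^↓_{N↓}) be orthonormal families in ℂ^Λ whose total energy is minimal, i.e. Σ_{σ∈{↑,↓}} Σ_{j=1}^{N_σ} ⟨φ^σ_j, h_{V^σ} φ^σ_j⟩ = S_{N↑}(h_{V^↑}) + S_{N↓}(h_{V^↓}). Then Σ_{σ∈{↑,↓}}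 Σ_{j=1}^{N_σ} Σ_{x ∈ Λ \ A_σ} |φ^σ_j(x)|² ≤ (3/(V₀ − 4d))·(B(A_↑) + B(A_↓)). -/
open MeasureTheory
open scoped Classical

/-- Exchange argument: a fractional occupation `c` of the levels `l` with total weight `N`
costs at least as much as some set of `N` levels. -/
lemma exists_card_eq_sum_le {n : Type*} [Fintype n] (l c : n → ℝ) (N : ℕ)
    (hc0 : ∀ i, 0 ≤ c i) (hc1 : ∀ i, c i ≤ 1) (hc : ∑ i, c i = N) :
    ∃ s : Finset n, s.card = N ∧ ∑ i ∈ s, l i ≤ ∑ i, l i * c i := by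
  have hN : N ≤ Fintype.card n := by
    have h : ∑ i, c i ≤ ∑ _i : n, (1 : ℝ) := Finset.sum_le_sum fun i _ => hc1 i
    rw [hc] at h
    simpa using h
  obtain ⟨s, hs, hmin⟩ := Finset.exists_min_image
    ((Finset.univ : Finset n).powersetCard N) (fun s => ∑ i ∈ s, l i)
    (Finset.powersetCard_nonempty.2 (by simpa using hN))
  have hcard : s.card = N := (Finset.mem_powersetCard.1 hs).2
  have hex : ∀ i ∈ s, ∀ j, j ∉ s → l i ≤ l j := by
    intro i hi j hj
    have hj' : j ∉ s.erase i := fun h => hj (Finset.mem_of_mem_erase h)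
    have hpos : 0 < s.card := Finset.card_pos.2 ⟨i, hi⟩
    have h := hmin (insert j (s.erase i)) (by
      rw [Finset.mem_powersetCard]
      refine ⟨Finset.subset_univ _, ?_⟩
      rw [Finset.card_insert_of_notMem hj', Finset.card_erase_of_mem hi]
      omega)
    simp only [Finset.sum_insert hj'] at h
    have h2 := Finset.add_sum_erase s l hi
    linarith
  refine ⟨s, hcard, ?_⟩
  obtain ⟨μ, hμ1, hμ2⟩ : ∃ μ : ℝ, (∀ i ∈ s, l i ≤ μ) ∧ ∀ j, j ∉ s → 0 ≤ c j * (l j - μ) := by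
    rcases s.eq_empty_or_nonempty with rfl | hne
    · refine ⟨0, by simp, fun j _ => ?_⟩
      have hz : ∑ i, c i = 0 := by rw [hc, ← hcard]; simp
      rw [(Finset.sum_eq_zero_iff_of_nonneg fun i _ => hc0 i).1 hz j (Finset.mem_univ j)]
      simp
    · obtain ⟨i, hi, hmax⟩ := Finset.exists_max_image s l hne
      exact ⟨l i, hmax, fun j hj => mul_nonneg (hc0 j) (sub_nonneg.2 (hex i hi j hj))⟩
  have hnonneg : 0 ≤ ∑ i, (l i - μ) * (c i - if i ∈ s then 1 else 0) := by
    refine Finset.sum_nonneg fun i _ => ?_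
    by_cases hi : i ∈ s
    · rw [if_pos hi]
      exact mul_nonneg_of_nonpos_of_nonpos (by linarith [hμ1 i hi]) (by linarith [hc1 i])
    · rw [if_neg hi]
      linarith [hμ2 i hi]
  have hexp : ∑ i, (l i - μ) * (c i - if i ∈ s then 1 else 0)
      = ∑ i, l i * c i - ∑ i ∈ s, l i - μ * (∑ i, c i - s.card) := by
    have h1 : ∑ i ∈ s, l i = ∑ i, l i * (if i ∈ s then 1 else 0) := by
      simp
    have h2 : (s.card : ℝ) = ∑ i, (if i ∈ s then 1 else 0) := by simp
    rw [h1, h2, ← Finset.sum_sub_distrib, ← Finset.sum_sub_distrib, Finset.mul_sum,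
      ← Finset.sum_sub_distrib]
    exact Finset.sum_congr rfl fun i _ => by ring
  rw [hexp, hc, hcard] at hnonneg
  linarith

/-- Variational principle for the sum of the `N` smallest eigenvalues, tested on a
one-particle density matrix. -/
lemma sumSmallest_le_trace {n : Type*} [Fintype n] [DecidableEq n] {M γ : Matrix n n ℝ}
    (hM : M.IsHermitian) (N : ℕ) (h0 : ∀ v : n → ℝ, 0 ≤ v ⬝ᵥ γ.mulVec v)
    (h1 : ∀ v : n → ℝ, v ⬝ᵥ γ.mulVec v ≤ v ⬝ᵥ v) (htr : γ.trace = N) :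
    sumSmallest M N ≤ (γ * M).trace := by
  set U : Matrix n n ℝ := (hM.eigenvectorUnitary : Matrix n n ℝ) with hU
  have hUU : U * star U = 1 := Unitary.coe_mul_star_self hM.eigenvectorUnitary
  have hUU' : star U * U = 1 := Unitary.coe_star_mul_self hM.eigenvectorUnitary
  have hspec : M = U * Matrix.diagonal hM.eigenvalues * star U := by
    have := hM.spectral_theorem
    simpa [Unitary.conjStarAlgAut_apply] using this
  set c : n → ℝ := fun i => (star U * γ * U) i i with hc
  have hci : ∀ i, c i = (U.col i) ⬝ᵥ γ.mulVec (U.col i) := by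
    intro i
    simp only [hc]
    rw [Matrix.mul_assoc]
    simp only [Matrix.mul_apply, dotProduct, Matrix.mulVec, Matrix.star_apply, star_trivial,
      Matrix.col_apply]
  have hnorm : ∀ i, (U.col i) ⬝ᵥ (U.col i) = 1 := by
    intro i
    have := congrFun (congrFun hUU' i) i
    simpa [Matrix.mul_apply, Matrix.star_apply, dotProduct] using this
  have hsum : ∑ i, c i = N := by
    rw [← htr]
    change (star U * γ * U).trace = _
    rw [Matrix.trace_mul_comm, ← Matrix.mul_assoc, hUU, Matrix.one_mul]
  have htrace : (γ * M).trace = ∑ i, hM.eigenvalues i * c i := by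
    conv_lhs => rw [hspec]
    rw [← Matrix.mul_assoc, Matrix.trace_mul_comm, ← Matrix.mul_assoc, ← Matrix.mul_assoc,
      Matrix.trace]
    exact Finset.sum_congr rfl fun i _ => by
      rw [Matrix.diag_apply, Matrix.mul_diagonal, mul_comm]
  obtain ⟨s, hs, hle⟩ := exists_card_eq_sum_le hM.eigenvalues c N
    (fun i => hci i ▸ h0 _) (fun i => by rw [hci, ← hnorm i]; exact h1 _) hsum
  rw [sumSmallest, dif_pos hM, htrace]
  refine le_trans (csInf_le (Set.toFinite _).bddBelow ?_) hle
  exact ⟨s, hs, rfl⟩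

/-- The nearest neighbours of a lattice point. -/
noncomputable def latticeNeighbors {d : ℕ} (x : Fin d → ℤ) : Finset (Fin d → ℤ) :=
  (Finset.univ : Finset (Fin d × Bool)).image
    fun p => Function.update x p.1 (x p.1 + if p.2 then 1 else -1)

lemma card_latticeNeighbors_le {d : ℕ} (x : Fin d → ℤ) :
    (latticeNeighbors x).card ≤ 2 * d := by
  refine Finset.card_image_le.trans ?_
  simp [mul_comm]

lemma mem_latticeNeighbors_of_dist1 {d : ℕ} {x y : Fin d → ℤ} (h : dist1 x y = 1) :
    y ∈ latticeNeighbors x := by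
  unfold dist1 at h
  obtain ⟨i, hi⟩ : ∃ i, (x i - y i).natAbs ≠ 0 := by
    by_contra! hall
    simp [hall] at h
  have hsplit := Finset.add_sum_erase Finset.univ (fun i => (x i - y i).natAbs)
    (Finset.mem_univ i)
  simp only [h] at hsplit
  have hz : ∑ j ∈ Finset.univ.erase i, (x j - y j).natAbs = 0 := by omega
  have hi1 : (x i - y i).natAbs = 1 := by omega
  have hne : ∀ j, j ≠ i → y j = x j := by
    intro j hj
    have := Finset.sum_eq_zero_iff.1 hz j (Finset.mem_erase.2 ⟨hj, Finset.mem_univ j⟩)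
    omega
  refine Finset.mem_image.2 ⟨(i, decide (y i = x i + 1)), Finset.mem_univ _, ?_⟩
  ext j
  by_cases hj : j = i
  · subst hj
    by_cases hy : y j = x j + 1
    · simp [hy]
    · simp only [hy, decide_false, Function.update_self]
      simp
      omega
  · simp [Function.update_of_ne hj, hne j hj]

/-- The hopping indicator of nearest-neighbour pairs. -/
noncomputable def adjInd {d : ℕ} (x y : Fin d → ℤ) : ℝ := if dist1 x y = 1 then 1 else 0

lemma adjInd_nonneg {d : ℕ} (x y : Fin d → ℤ) : 0 ≤ adjInd x y := by
  unfold adjInd; split_ifs <;> norm_num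

lemma adjInd_comm {d : ℕ} (x y : Fin d → ℤ) : adjInd x y = adjInd y x := by
  unfold adjInd; rw [dist1_comm]

lemma adjInd_self {d : ℕ} (x : Fin d → ℤ) : adjInd x x = 0 := by
  simp [adjInd, dist1]

lemma sum_adjInd_le {d : ℕ} (Λ : Finset (Fin d → ℤ)) (x : Fin d → ℤ) :
    ∑ y : Λ, adjInd x y ≤ 2 * d := by
  rw [Finset.sum_coe_sort Λ (adjInd x)]
  unfold adjInd
  rw [Finset.sum_boole]
  have h : (Λ.filter fun y => dist1 x y = 1) ⊆ latticeNeighbors x := fun y hy =>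
    mem_latticeNeighbors_of_dist1 (Finset.mem_filter.1 hy).2
  exact_mod_cast (Finset.card_le_card h).trans (card_latticeNeighbors_le x)

lemma sum_adjInd_mul_mean_le {d : ℕ} (Λ : Finset (Fin d → ℤ)) (f : Λ → ℝ)
    (hf : ∀ x, 0 ≤ f x) :
    ∑ x : Λ, ∑ y : Λ, adjInd (x : Fin d → ℤ) y * ((f x + f y) / 2) ≤ 2 * d * ∑ x, f x := by
  have h1 : ∑ x : Λ, ∑ y : Λ, adjInd (x : Fin d → ℤ) y * f x ≤ 2 * d * ∑ x, f x := by
    rw [Finset.mul_sum]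
    refine Finset.sum_le_sum fun x _ => ?_
    rw [← Finset.sum_mul]
    exact mul_le_mul_of_nonneg_right (sum_adjInd_le Λ x) (hf x)
  have h2 : ∑ x : Λ, ∑ y : Λ, adjInd (x : Fin d → ℤ) y * f y
      = ∑ x : Λ, ∑ y : Λ, adjInd (x : Fin d → ℤ) y * f x := by
    rw [Finset.sum_comm]
    exact Finset.sum_congr rfl fun x _ => Finset.sum_congr rfl fun y _ => by
      rw [adjInd_comm]
  have h3 : ∑ x : Λ, ∑ y : Λ, adjInd (x : Fin d → ℤ) y * ((f x + f y) / 2)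
      = (∑ x : Λ, ∑ y : Λ, adjInd (x : Fin d → ℤ) y * f x
        + ∑ x : Λ, ∑ y : Λ, adjInd (x : Fin d → ℤ) y * f y) / 2 := by
    simp only [← Finset.sum_add_distrib, Finset.sum_div]
    exact Finset.sum_congr rfl fun x _ => Finset.sum_congr rfl fun y _ => by ring
  rw [h3, h2]
  linarith

lemma sum_adjInd_boundary_le {d : ℕ} (Λ A : Finset (Fin d → ℤ)) :
    ∑ x : Λ, ∑ y : Λ, adjInd (x : Fin d → ℤ) y *
      ((if (x : Fin d → ℤ) ∈ A then 1 else 0) * (1 - if (y : Fin d → ℤ) ∈ A then 1 else 0))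
      ≤ (bdry (A : Set (Fin d → ℤ)) : ℝ) := by
  have hfin : {p : (Fin d → ℤ) × (Fin d → ℤ) | p.1 ∈ (A : Set (Fin d → ℤ)) ∧
      p.2 ∉ (A : Set (Fin d → ℤ)) ∧ dist1 p.1 p.2 = 1}.Finite := by
    refine ((A ×ˢ A.biUnion latticeNeighbors : Finset _).finite_toSet).subset ?_
    rintro ⟨x, y⟩ ⟨hx, -, hxy⟩
    rw [Finset.mem_coe, Finset.mem_product, Finset.mem_biUnion]
    exact ⟨hx, x, hx, mem_latticeNeighbors_of_dist1 hxy⟩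
  have hsum : ∑ x : Λ, ∑ y : Λ, adjInd (x : Fin d → ℤ) y *
      ((if (x : Fin d → ℤ) ∈ A then 1 else 0) * (1 - if (y : Fin d → ℤ) ∈ A then 1 else 0))
      = (((Λ ×ˢ Λ).filter fun p => p.1 ∈ A ∧ p.2 ∉ A ∧ dist1 p.1 p.2 = 1).card : ℝ) := by
    rw [← Finset.sum_boole, Finset.sum_product, ← Finset.sum_coe_sort Λ]
    refine Finset.sum_congr rfl fun x _ => ?_
    rw [← Finset.sum_coe_sort Λ]
    refine Finset.sum_congr rfl fun y _ => ?_
    by_cases hx : (x : Fin d → ℤ) ∈ A <;> by_cases hy : (y : Fin d → ℤ) ∈ A <;>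
      simp [adjInd, hx, hy]
  rw [hsum, bdry, ← Set.ncard_coe_finset]
  refine Nat.cast_le.2 (Set.ncard_le_ncard ?_ hfin)
  intro p hp
  simpa using (Finset.mem_filter.1 hp).2

lemma trace_mul_hV {d : ℕ} (Λ : Finset (Fin d → ℤ)) (V : (Fin d → ℤ) → ℝ)
    (r : Matrix Λ Λ ℝ) :
    (r * hV d Λ V).trace
      = ∑ x : Λ, V x * r x x - ∑ x : Λ, ∑ y : Λ, adjInd (x : Fin d → ℤ) y * r x y := by
  rw [Matrix.trace, ← Finset.sum_sub_distrib]
  refine Finset.sum_congr rfl fun x _ => ?_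
  rw [Matrix.diag_apply, Matrix.mul_apply]
  have hterm : ∀ y : Λ, r x y * hV d Λ V y x
      = (if y = x then V x * r x x else 0) - adjInd (x : Fin d → ℤ) y * r x y := by
    intro y
    by_cases hyx : y = x
    · subst hyx
      simp [hV, adjInd, dist1, mul_comm]
    · have hyx' : (y : Fin d → ℤ) ≠ x := fun h => hyx (Subtype.ext h)
      simp only [hV, adjInd, dist1_comm (y : Fin d → ℤ), hyx, hyx', if_false]
      split_ifs <;> ring
  simp [hterm, Finset.sum_sub_distrib]

lemma quadForm_single_add {n : Type*} [Fintype n] [DecidableEq n] {r : Matrix n n ℝ}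
    (x y : n) (t : ℝ) :
    (Pi.single x 1 + Pi.single y t : n → ℝ) ⬝ᵥ r.mulVec (Pi.single x 1 + Pi.single y t)
      = r x x + t * r x y + t * r y x + t ^ 2 * r y y := by
  simp only [Matrix.mulVec_add, add_dotProduct, dotProduct_add, Matrix.mulVec_single,
    single_dotProduct, Pi.smul_apply, Matrix.col_apply, MulOpposite.smul_eq_mul_unop,
    MulOpposite.unop_op]
  ring

/-- A density matrix `r` with `N ≤ |A|` particles loses energy at least `V₀ - 4d` per unit of
weight outside the favourable set, up to a boundary term. -/
lemma outside_weight_le {d : ℕ} (Λ : Finset (Fin d → ℤ)) (V : (Fin d → ℤ) → ℝ) (V0 : ℝ)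
    (hV0 : ∀ x ∈ Λ, V x ≠ 0 → V0 ≤ V x) (N : ℕ) (hN : N ≤ (Aset d Λ V).card)
    (r : Matrix Λ Λ ℝ) (hr : r.transpose = r) (h0 : ∀ v : Λ → ℝ, 0 ≤ v ⬝ᵥ r.mulVec v)
    (h1 : ∀ v : Λ → ℝ, v ⬝ᵥ r.mulVec v ≤ v ⬝ᵥ v) (htr : r.trace = N) :
    (V0 - 4 * d) * ∑ x ∈ Finset.univ.filter
        (fun x : Λ => (x : Fin d → ℤ) ∉ Aset d Λ V), r x x
      ≤ (r * hV d Λ V).trace - SN d Λ V N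
        + 2 * (bdry (Aset d Λ V : Set (Fin d → ℤ)) : ℝ) := by
  set A := Aset d Λ V with hA
  set a : Λ → ℝ := fun x => if (x : Fin d → ℤ) ∈ A then 1 else 0 with ha
  have hsymm : ∀ x y, r y x = r x y := fun x y => congrFun (congrFun hr x) y
  have ha01 : ∀ x, a x = 0 ∨ a x = 1 := by
    intro x; by_cases h : (x : Fin d → ℤ) ∈ A <;> simp [ha, h]
  have hdiag0 : ∀ x, 0 ≤ r x x := by
    intro x
    have := h0 (Pi.single x 1 + Pi.single x 0)
    rw [quadForm_single_add] at this
    linarith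
  have hdiag1 : ∀ x, r x x ≤ 1 := by
    intro x
    have := h1 (Pi.single x 1)
    simpa using this
  have hoff : ∀ x y, r x y ≤ (r x x + r y y) / 2 := by
    intro x y
    have := h0 (Pi.single x 1 + Pi.single y (-1))
    rw [quadForm_single_add, hsymm x y] at this
    linarith
  have hoff' : ∀ x y, x ≠ y → r x y ≤ ((1 - r x x) + (1 - r y y)) / 2 := by
    intro x y hxy
    have := h1 (Pi.single x 1 + Pi.single y 1)
    rw [quadForm_single_add, hsymm x y] at this
    simp [hxy, hxy.symm] at this
    linarith
  set w : ℝ := ∑ x ∈ Finset.univ.filter (fun x : Λ => (x : Fin d → ℤ) ∉ A), r x x with hw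
  have hw' : w = ∑ x, (1 - a x) * r x x := by
    rw [hw, Finset.sum_filter]
    refine Finset.sum_congr rfl fun x _ => ?_
    by_cases h : (x : Fin d → ℤ) ∈ A <;> simp [ha, h]
  have hw0 : 0 ≤ w := Finset.sum_nonneg fun x _ => hdiag0 x
  have hacard : ∑ x, a x = A.card := by
    rw [Finset.sum_coe_sort Λ (fun x => if x ∈ A then (1 : ℝ) else 0), Finset.sum_boole]
    congr 2
    ext x
    simp only [Finset.mem_filter, hA, Aset]
    tauto
  have hin : ∑ x, a x * r x x = N - w := by
    rw [hw', ← htr, Matrix.trace, ← Finset.sum_sub_distrib]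
    exact Finset.sum_congr rfl fun x _ => by rw [Matrix.diag_apply]; ring
  have hhole : ∑ x, a x * (1 - r x x) = A.card - N + w := by
    have : ∑ x, a x * (1 - r x x) = ∑ x, a x - ∑ x, a x * r x x := by
      rw [← Finset.sum_sub_distrib]
      exact Finset.sum_congr rfl fun x _ => by ring
    rw [this, hacard, hin]; ring
  have hNA : (N : ℝ) ≤ A.card := by exact_mod_cast hN
  obtain ⟨t, ht0, ht1, ht⟩ : ∃ t : ℝ, 0 ≤ t ∧ t ≤ 1 ∧ t * ((A.card : ℝ) - N + w) = w := by
    rcases eq_or_lt_of_le (show 0 ≤ (A.card : ℝ) - N + w by linarith) with h | h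
    · exact ⟨0, le_rfl, zero_le_one, by linarith⟩
    · exact ⟨w / ((A.card : ℝ) - N + w), div_nonneg hw0 h.le,
        (div_le_one h).2 (by linarith), div_mul_cancel₀ _ h.ne'⟩
  set γ : Matrix Λ Λ ℝ :=
    Matrix.diagonal a * ((1 - t) • r + t • (1 : Matrix Λ Λ ℝ)) * Matrix.diagonal a with hγ
  have hγapp : ∀ x y, γ x y = a x * ((1 - t) * r x y + t * if x = y then 1 else 0) * a y := by
    intro x y
    simp [hγ, Matrix.mul_diagonal, Matrix.diagonal_mul, Matrix.one_apply]
  have hγq : ∀ v : Λ → ℝ, v ⬝ᵥ γ.mulVec v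
      = (1 - t) * ((a * v) ⬝ᵥ r.mulVec (a * v)) + t * ((a * v) ⬝ᵥ (a * v)) := by
    intro v
    have hd : (Matrix.diagonal a).mulVec v = a * v := by
      ext x; simp [Matrix.mulVec_diagonal]
    have hd' : Matrix.vecMul v (Matrix.diagonal a) = a * v := by
      ext x; simp [Matrix.vecMul_diagonal, mul_comm]
    rw [hγ, ← Matrix.mulVec_mulVec, ← Matrix.mulVec_mulVec, hd, Matrix.dotProduct_mulVec, hd',
      Matrix.add_mulVec, Matrix.smul_mulVec, Matrix.smul_mulVec, Matrix.one_mulVec,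
      dotProduct_add, dotProduct_smul, dotProduct_smul, smul_eq_mul, smul_eq_mul]
  have hself : ∀ v : Λ → ℝ, 0 ≤ (a * v) ⬝ᵥ (a * v) ∧ (a * v) ⬝ᵥ (a * v) ≤ v ⬝ᵥ v := by
    intro v
    refine ⟨Finset.sum_nonneg fun x _ => mul_self_nonneg _,
      Finset.sum_le_sum fun x _ => ?_⟩
    rcases ha01 x with h | h <;> simp [h, mul_self_nonneg]
  have hγtr : γ.trace = N := by
    have : γ.trace = ∑ x, a x * r x x + t * ∑ x, a x * (1 - r x x) := by
      rw [Matrix.trace, Finset.mul_sum, ← Finset.sum_add_distrib]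
      refine Finset.sum_congr rfl fun x _ => ?_
      rw [Matrix.diag_apply, hγapp]
      rcases ha01 x with h | h <;> simp [h]
      ring
    rw [this, hin, hhole, ht]; ring
  have hvar : SN d Λ V N ≤ (γ * hV d Λ V).trace := by
    refine sumSmallest_le_trace (hV_isHermitian d Λ V) N (fun v => ?_) (fun v => ?_) hγtr
    · rw [hγq]
      exact add_nonneg (mul_nonneg (by linarith) (h0 _)) (mul_nonneg ht0 (hself v).1)
    · rw [hγq]
      have := mul_le_mul_of_nonneg_left (h1 (a * v)) (by linarith : 0 ≤ 1 - t)
      linarith [(hself v).2]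
  rw [trace_mul_hV Λ V γ] at hvar
  rw [trace_mul_hV Λ V r]
  have hVA : ∀ x : Λ, a x * V x = 0 := by
    intro x
    by_cases h : (x : Fin d → ℤ) ∈ A
    · simp [(Finset.mem_filter.1 h).2]
    · simp [ha, h]
  have hpotγ : ∑ x : Λ, V x * γ x x = 0 := Finset.sum_eq_zero fun x _ => by
    rw [hγapp]
    linear_combination (((1 - t) * r x x + t * if x = x then 1 else 0) * a x) * hVA x
  have hpot : V0 * w ≤ ∑ x : Λ, V x * r x x := by
    rw [hw', Finset.mul_sum]
    refine Finset.sum_le_sum fun x _ => ?_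
    by_cases h : (x : Fin d → ℤ) ∈ A
    · simp [ha, h, (Finset.mem_filter.1 h).2]
    · have hx : V x ≠ 0 := fun hz => h (Finset.mem_filter.2 ⟨x.2, hz⟩)
      have := mul_le_mul_of_nonneg_right (hV0 x x.2 hx) (hdiag0 x)
      simpa [ha, h] using this
  set K : ℝ := ∑ x : Λ, ∑ y : Λ, adjInd (x : Fin d → ℤ) y * (a x * r x y * a y) with hK
  have hkinγ : ∑ x : Λ, ∑ y : Λ, adjInd (x : Fin d → ℤ) y * γ x y = (1 - t) * K := by
    rw [hK, Finset.mul_sum]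
    refine Finset.sum_congr rfl fun x _ => ?_
    rw [Finset.mul_sum]
    refine Finset.sum_congr rfl fun y _ => ?_
    rw [hγapp]
    by_cases h : x = y
    · subst h; simp [adjInd_self]
    · simp only [h, if_false]; ring
  have hKle : K ≤ 2 * d * ((A.card : ℝ) - N + w) := by
    rw [← hhole]
    refine le_trans ?_ (sum_adjInd_mul_mean_le Λ (fun x => a x * (1 - r x x)) fun x => ?_)
    · refine Finset.sum_le_sum fun x _ => Finset.sum_le_sum fun y _ => ?_
      by_cases hxy : x = y
      · subst hxy; simp [adjInd_self]
      refine mul_le_mul_of_nonneg_left ?_ (adjInd_nonneg _ _)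
      have := hoff' x y hxy
      have hx := hdiag1 x
      have hy := hdiag1 y
      rcases ha01 x with h | h <;> rcases ha01 y with h' | h' <;> simp [h, h'] <;> linarith
    · have hx := hdiag1 x
      rcases ha01 x with h | h <;> simp [h]
      exact hx
  have hkin : ∑ x : Λ, ∑ y : Λ, adjInd (x : Fin d → ℤ) y * r x y
      ≤ K + 2 * d * w + 2 * (bdry (A : Set (Fin d → ℤ)) : ℝ) := by
    have hout : ∑ x : Λ, ∑ y : Λ, adjInd (x : Fin d → ℤ) y *
        (((1 - a x) * r x x + (1 - a y) * r y y) / 2) ≤ 2 * d * w := by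
      rw [hw']
      refine sum_adjInd_mul_mean_le Λ (fun x => (1 - a x) * r x x) fun x => ?_
      have hx := hdiag0 x
      rcases ha01 x with h | h <;> simp [h]
      exact hx
    have hb := sum_adjInd_boundary_le Λ A
    have hb' : ∑ x : Λ, ∑ y : Λ, adjInd (x : Fin d → ℤ) y * (a y * (1 - a x))
        = ∑ x : Λ, ∑ y : Λ, adjInd (x : Fin d → ℤ) y * (a x * (1 - a y)) := by
      rw [Finset.sum_comm]
      exact Finset.sum_congr rfl fun x _ => Finset.sum_congr rfl fun y _ => by
        rw [adjInd_comm]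
    have hpt : ∑ x : Λ, ∑ y : Λ, adjInd (x : Fin d → ℤ) y * r x y
        ≤ ∑ x : Λ, ∑ y : Λ, (adjInd (x : Fin d → ℤ) y * (a x * r x y * a y)
          + adjInd (x : Fin d → ℤ) y * (((1 - a x) * r x x + (1 - a y) * r y y) / 2)
          + adjInd (x : Fin d → ℤ) y * (a x * (1 - a y))
          + adjInd (x : Fin d → ℤ) y * (a y * (1 - a x))) := by
      refine Finset.sum_le_sum fun x _ => Finset.sum_le_sum fun y _ => ?_
      rw [← mul_add, ← mul_add, ← mul_add]
      refine mul_le_mul_of_nonneg_left ?_ (adjInd_nonneg _ _)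
      have := hoff x y
      have hx := hdiag0 x
      have hy := hdiag0 y
      have hx1 := hdiag1 x
      have hy1 := hdiag1 y
      rcases ha01 x with h | h <;> rcases ha01 y with h' | h' <;> simp [h, h'] <;> linarith
    simp only [Finset.sum_add_distrib] at hpt
    rw [hb'] at hpt
    linarith
  rw [hpotγ, hkinγ] at hvar
  have htK := mul_le_mul_of_nonneg_left hKle ht0
  have htK' : t * (2 * d * ((A.card : ℝ) - N + w)) = 2 * d * w := by
    linear_combination (2 * d : ℝ) * ht
  linarith

/-- The real part of the one-particle density matrix of a family of orbitals. -/
noncomputable def reDensity {n ι : Type*} [Fintype ι] (φ : ι → EuclideanSpace ℂ n) :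
    Matrix n n ℝ :=
  fun x y => ∑ j, ((starRingEnd ℂ) (φ j x) * φ j y).re

lemma reDensity_transpose {n ι : Type*} [Fintype ι] (φ : ι → EuclideanSpace ℂ n) :
    (reDensity φ).transpose = reDensity φ := by
  ext x y
  refine Finset.sum_congr rfl fun j _ => ?_
  simp only [Complex.mul_re, Complex.conj_re, Complex.conj_im]
  ring

lemma reDensity_diag {n ι : Type*} [Fintype ι] (φ : ι → EuclideanSpace ℂ n) (x : n) :
    reDensity φ x x = ∑ j, ‖φ j x‖ ^ 2 := by
  refine Finset.sum_congr rfl fun j _ => ?_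
  rw [← Complex.normSq_eq_norm_sq, Complex.normSq_apply, Complex.mul_re, Complex.conj_re,
    Complex.conj_im]
  ring

lemma reDensity_quadForm {n ι : Type*} [Fintype n] [Fintype ι] (φ : ι → EuclideanSpace ℂ n)
    (v : n → ℝ) :
    v ⬝ᵥ (reDensity φ).mulVec v
      = ∑ j, ‖inner ℂ (φ j) (WithLp.toLp 2 fun x => (v x : ℂ))‖ ^ 2 := by
  have hj : ∀ j, ‖inner ℂ (φ j) (WithLp.toLp 2 fun x => (v x : ℂ))‖ ^ 2
      = ∑ x, ∑ y, v x * (v y * ((starRingEnd ℂ) (φ j x) * φ j y).re) := by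
    intro j
    have hin : inner ℂ (φ j) (WithLp.toLp 2 fun x => (v x : ℂ))
        = ∑ x, (v x : ℂ) * (starRingEnd ℂ) (φ j x) := by
      simp [PiLp.inner_apply]
    rw [hin, ← Complex.normSq_eq_norm_sq, Complex.normSq_apply, Complex.re_sum, Complex.im_sum,
      Finset.sum_mul_sum, Finset.sum_mul_sum, ← Finset.sum_add_distrib]
    refine Finset.sum_congr rfl fun x _ => ?_
    rw [← Finset.sum_add_distrib]
    refine Finset.sum_congr rfl fun y _ => ?_
    simp only [Complex.mul_re, Complex.mul_im, Complex.conj_re, Complex.conj_im,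
      Complex.ofReal_re, Complex.ofReal_im]
    ring
  simp only [hj, dotProduct, Matrix.mulVec, reDensity, Finset.mul_sum, Finset.sum_mul]
  conv_rhs => rw [Finset.sum_comm]
  refine Finset.sum_congr rfl fun x _ => ?_
  conv_rhs => rw [Finset.sum_comm]
  exact Finset.sum_congr rfl fun y _ => Finset.sum_congr rfl fun j _ => by ring

lemma reDensity_quadForm_le {n ι : Type*} [Fintype n] [Fintype ι]
    {φ : ι → EuclideanSpace ℂ n} (hφ : Orthonormal ℂ φ) (v : n → ℝ) :
    v ⬝ᵥ (reDensity φ).mulVec v ≤ v ⬝ᵥ v := by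
  rw [reDensity_quadForm]
  refine (hφ.sum_inner_products_le _).trans_eq ?_
  rw [EuclideanSpace.norm_sq_eq]
  simp [dotProduct, sq]

lemma reDensity_trace {n ι : Type*} [Fintype n] [Fintype ι]
    {φ : ι → EuclideanSpace ℂ n} (hφ : Orthonormal ℂ φ) :
    (reDensity φ).trace = Fintype.card ι := by
  simp only [Matrix.trace, Matrix.diag_apply, reDensity_diag]
  rw [Finset.sum_comm]
  simp [← EuclideanSpace.norm_sq_eq, hφ.1]

lemma energy_re {n ι : Type*} [Fintype n] [Fintype ι] (φ : ι → EuclideanSpace ℂ n)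
    {M : Matrix n n ℝ} (hM : M.IsHermitian) :
    (∑ j, ∑ x, ∑ y, (starRingEnd ℂ) (φ j x) * ((M x y : ℝ) : ℂ) * φ j y).re
      = (reDensity φ * M).trace := by
  simp only [Complex.re_sum, Matrix.trace, Matrix.diag_apply, Matrix.mul_apply, reDensity,
    Finset.sum_mul]
  rw [Finset.sum_comm]
  refine Finset.sum_congr rfl fun x _ => ?_
  rw [Finset.sum_comm]
  refine Finset.sum_congr rfl fun y _ => Finset.sum_congr rfl fun j _ => ?_
  have : M y x = M x y := by simpa using hM.apply x y
  rw [this, mul_right_comm, Complex.re_mul_ofReal]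

lemma orthonormal_outside_weight_le {d : ℕ} (Λ : Finset (Fin d → ℤ)) (V : (Fin d → ℤ) → ℝ)
    (V0 : ℝ) (hV0 : ∀ x ∈ Λ, V x ≠ 0 → V0 ≤ V x) (N : ℕ) (hN : N ≤ (Aset d Λ V).card)
    (φ : Fin N → EuclideanSpace ℂ Λ) (hφ : Orthonormal ℂ φ) :
    (V0 - 4 * d) * ∑ j, ∑ x ∈ Finset.univ.filter
        (fun x : Λ => (x : Fin d → ℤ) ∉ Aset d Λ V), ‖φ j x‖ ^ 2
      ≤ (∑ j, ∑ x : Λ, ∑ y : Λ,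
          (starRingEnd ℂ) (φ j x) * ((hV d Λ V x y : ℝ) : ℂ) * φ j y).re - SN d Λ V N
        + 2 * (bdry (Aset d Λ V : Set (Fin d → ℤ)) : ℝ) := by
  rw [energy_re φ (hV_isHermitian d Λ V), Finset.sum_comm]
  simp only [← reDensity_diag]
  exact outside_weight_le Λ V V0 hV0 N hN (reDensity φ) (reDensity_transpose φ)
    (fun v => by rw [reDensity_quadForm]; positivity) (reDensity_quadForm_le hφ)
    (by simpa using reDensity_trace hφ)

/-- Proposition 2 (non-interacting form): if orthonormal families `(φ^↑_j)`,
`(φ^↓_j)` in `ℂ^Λ` minimize the total energy, i.e. their total energy equals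
`S_{N↑}(h_{V↑}) + S_{N↓}(h_{V↓})`, then the total weight they carry outside the
favorable sets is at most `(3/(V₀ - 4d))·(B(A_↑) + B(A_↓))`. -/
theorem stmt14 (d : ℕ) (hd : 1 ≤ d) (Λ : Finset (Fin d → ℤ))
    (Vup Vdn : (Fin d → ℤ) → ℝ)
    (hVup : ∀ x ∈ Λ, 0 ≤ Vup x) (hVdn : ∀ x ∈ Λ, 0 ≤ Vdn x)
    (hdisj : Aset d Λ Vup ∩ Aset d Λ Vdn = ∅)
    (hup : (Aset d Λ Vup).Nonempty) (hdn : (Aset d Λ Vdn).Nonempty)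
    (V0 : ℝ)
    (hV0low : ∀ x ∈ Λ, (Vup x ≠ 0 → V0 ≤ Vup x) ∧ (Vdn x ≠ 0 → V0 ≤ Vdn x))
    (hV0 : 2*(d:ℝ)*(Real.sqrt d + 1) < V0)
    (Nup Ndn : ℕ)
    (hNup : Nup ≤ (Aset d Λ Vup).card) (hNdn : Ndn ≤ (Aset d Λ Vdn).card)
    (φup : Fin Nup → EuclideanSpace ℂ Λ) (φdn : Fin Ndn → EuclideanSpace ℂ Λ)
    (honup : Orthonormal ℂ φup) (hondn : Orthonormal ℂ φdn)
    (hmin :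
      (∑ j, ∑ x : Λ, ∑ y : Λ,
          (starRingEnd ℂ) (φup j x) * ((hV d Λ Vup x y : ℝ) : ℂ) * φup j y)
      + (∑ j, ∑ x : Λ, ∑ y : Λ,
          (starRingEnd ℂ) (φdn j x) * ((hV d Λ Vdn x y : ℝ) : ℂ) * φdn j y)
      = ((SN d Λ Vup Nup + SN d Λ Vdn Ndn : ℝ) : ℂ)) :
    (∑ j, ∑ x ∈ Finset.univ.filter
        (fun x : Λ => (x : Fin d → ℤ) ∉ Aset d Λ Vup), ‖φup j x‖^2)
    + (∑ j, ∑ x ∈ Finset.univ.filter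
        (fun x : Λ => (x : Fin d → ℤ) ∉ Aset d Λ Vdn), ‖φdn j x‖^2)
    ≤ 3/(V0 - 4*(d:ℝ)) *
        ((bdry (↑(Aset d Λ Vup) : Set (Fin d → ℤ)) : ℝ)
          + (bdry (↑(Aset d Λ Vdn) : Set (Fin d → ℤ)) : ℝ)) := by
  have hVd : 0 < V0 - 4 * (d : ℝ) := by
    have h1 : (1 : ℝ) ≤ Real.sqrt d := Real.one_le_sqrt.2 (by exact_mod_cast hd)
    have h2 : (0 : ℝ) ≤ d := Nat.cast_nonneg d
    nlinarith
  have h_up := orthonormal_outside_weight_le Λ Vup V0 (fun x hx => (hV0low x hx).1) Nup hNup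
    φup honup
  have h_dn := orthonormal_outside_weight_le Λ Vdn V0 (fun x hx => (hV0low x hx).2) Ndn hNdn
    φdn hondn
  have hre := congrArg Complex.re hmin
  rw [Complex.add_re, Complex.ofReal_re] at hre
  have hb_up : (0 : ℝ) ≤ bdry (↑(Aset d Λ Vup) : Set (Fin d → ℤ)) := Nat.cast_nonneg _
  have hb_dn : (0 : ℝ) ≤ bdry (↑(Aset d Λ Vdn) : Set (Fin d → ℤ)) := Nat.cast_nonneg _
  rw [div_mul_eq_mul_div, le_div_iff₀ hVd]
  linarith
end
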